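/- Let k, m ∈ ℕ and let α ∈ (k−1, k) be a non-integer real with α + m > 1/2. There exists a constant C > 0, depending only on α and m, such that for every integer p with α + m < p + 1 and every ω ∈ 𝒰^{α,m}_{1−}((−1,1)), the Gauss–Radau projections satisfy ‖ω − Π_p^− ω‖_{L²(−1,1)} ≤ C · p^{−min{2α+1/2, α+m−1/2}} · U^{α,m}_{1−}(ω;(−1,1)) and ‖ω − Π_p^+ ω‖_{L²(−1,1)} ≤ C · p^{−min{2α+1, α+m−1/2}} · U^{α,m}_{1−}(ω;(−1,1)). -/

import Mathlib

open MeasureTheory Set Filter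

/-- The right Caputo fractional derivative of order `α ∈ (k−1,k)` based at `b`:
`(^C D^α_{b−} u)(x) = ((−1)^k/Γ(k−α)) ∫_x^b (y−x)^{k−α−1} u^{(k)}(y) dy`. -/
noncomputable def caputoR (k : ℕ) (α b : ℝ) (u : ℝ → ℝ) (x : ℝ) : ℝ :=
  ((-1 : ℝ) ^ k / Real.Gamma ((k : ℝ) - α)) *
    ∫ y in x..b, (y - x) ^ ((k : ℝ) - α - 1) * iteratedDeriv k u y

/-- Membership `ω ∈ 𝒰^{α,m}_{1−}((−1,1))`: `ω ∈ W^{k,1}(−1,1)` and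
`^C D^α_{1−} ω ∈ W^{m,1}(−1,1)`, with `L i` the (finite) left-hand limits
`D^i(^C D^α_{1−} ω)(1−)` for `i < m`. -/
def MemUR (k m : ℕ) (α : ℝ) (ω : ℝ → ℝ) (L : ℕ → ℝ) : Prop :=
  ContinuousOn ω (Icc (-1 : ℝ) 1) ∧
  (∀ i < k, ∀ x ∈ Ioo (-1 : ℝ) 1,
      HasDerivAt (iteratedDeriv i ω) (iteratedDeriv (i + 1) ω x) x) ∧
  (∀ i ≤ k, IntervalIntegrable (iteratedDeriv i ω) volume (-1) 1) ∧
  (∀ i < m, ∀ x ∈ Ioo (-1 : ℝ) 1,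
      HasDerivAt (iteratedDeriv i (caputoR k α 1 ω))
        (iteratedDeriv (i + 1) (caputoR k α 1 ω) x) x) ∧
  (∀ i ≤ m, IntervalIntegrable (iteratedDeriv i (caputoR k α 1 ω)) volume (-1) 1) ∧
  (∀ i < m, Tendsto (iteratedDeriv i (caputoR k α 1 ω))
      (nhdsWithin (1 : ℝ) (Iio 1)) (nhds (L i)))

/-- The semi-norm `U^{α,m}_{1−}(ω;(−1,1))`. -/
noncomputable def UsemiR (k m : ℕ) (α : ℝ) (ω : ℝ → ℝ) (L : ℕ → ℝ) : ℝ :=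
  (∫ x in (-1 : ℝ)..1, |iteratedDeriv m (caputoR k α 1 ω) x|) +
    ∑ i ∈ Finset.range m, |L i|

open Polynomial

/-! ### Legendre polynomials -/

/-- The Legendre polynomials, through their three-term recurrence. -/
noncomputable def legendreP : ℕ → ℝ[X]
  | 0 => 1
  | 1 => X
  | (n + 2) => C (((n : ℝ) + 2)⁻¹) *
      (C (2 * (n : ℝ) + 3) * X * legendreP (n + 1) - C ((n : ℝ) + 1) * legendreP n)

theorem legendreP_zero : legendreP 0 = 1 := by simp [legendreP]

theorem legendreP_one : legendreP 1 = X := by simp [legendreP]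

theorem legendreP_recurrence (n : ℕ) :
    C ((n : ℝ) + 2) * legendreP (n + 2) =
      C (2 * (n : ℝ) + 3) * X * legendreP (n + 1) - C ((n : ℝ) + 1) * legendreP n := by
  have h : ((n : ℝ) + 2) ≠ 0 := by positivity
  rw [legendreP, ← mul_assoc, ← C_mul, mul_inv_cancel₀ h, C_1, one_mul]

theorem legendreP_eval_recurrence (n : ℕ) (x : ℝ) :
    ((n : ℝ) + 2) * (legendreP (n + 2)).eval x =
      (2 * (n : ℝ) + 3) * x * (legendreP (n + 1)).eval x
        - ((n : ℝ) + 1) * (legendreP n).eval x := by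
  simpa only [eval_mul, eval_sub, eval_C, eval_X] using
    congrArg (Polynomial.eval x) (legendreP_recurrence n)

theorem legendreP_derivative_aux (n : ℕ) :
    (derivative (legendreP (n + 1)) - X * derivative (legendreP n) =
        C ((n : ℝ) + 1) * legendreP n) ∧
      (X * derivative (legendreP (n + 1)) - derivative (legendreP n) =
        C ((n : ℝ) + 1) * legendreP (n + 1)) := by
  induction n with
  | zero => simp [legendreP_zero, legendreP_one]
  | succ n ih =>
    obtain ⟨ha, hb⟩ := ih
    have hr := legendreP_recurrence n
    have hd := congrArg derivative hr
    simp only [derivative_mul, derivative_sub, derivative_C, derivative_X, zero_mul, zero_add,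
      mul_one] at hd
    have h2 : C ((n : ℝ) + 2) ≠ 0 := by
      rw [Ne, C_eq_zero]; positivity
    simp only [C_add, C_mul, map_ofNat, C_1, map_natCast, Nat.cast_add, Nat.cast_one] at *
    have hA : derivative (legendreP (n + 2)) - X * derivative (legendreP (n + 1)) =
        ((n : ℝ[X]) + 1 + 1) * legendreP (n + 1) := by
      apply mul_left_cancel₀ h2
      linear_combination hd + ((n : ℝ[X]) + 1) * hb
    refine ⟨hA, ?_⟩
    linear_combination X * hA + X * hb - ha - hr

theorem derivative_legendreP_succ (n : ℕ) :
    derivative (legendreP (n + 1)) =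
      X * derivative (legendreP n) + C ((n : ℝ) + 1) * legendreP n := by
  linear_combination (legendreP_derivative_aux n).1

theorem X_mul_derivative_legendreP_succ (n : ℕ) :
    X * derivative (legendreP (n + 1)) =
      derivative (legendreP n) + C ((n : ℝ) + 1) * legendreP (n + 1) := by
  linear_combination (legendreP_derivative_aux n).2

theorem derivative_legendreP_sub (n : ℕ) :
    derivative (legendreP (n + 2) - legendreP n) = C (2 * (n : ℝ) + 3) * legendreP (n + 1) := by
  have h1 := derivative_legendreP_succ (n + 1)
  have h2 := X_mul_derivative_legendreP_succ n
  simp only [C_add, C_mul, map_ofNat, C_1, map_natCast, Nat.cast_add, Nat.cast_one,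
    derivative_sub] at *
  linear_combination h1 + h2

theorem legendreP_jacobi_identity (n : ℕ) :
    (X - 1) * derivative (legendreP (n + 1) + legendreP n) =
      C ((n : ℝ) + 1) * (legendreP (n + 1) - legendreP n) := by
  rw [derivative_add]
  linear_combination X_mul_derivative_legendreP_succ n - derivative_legendreP_succ n

theorem legendreP_structure (n : ℕ) :
    (X ^ 2 - 1) * derivative (legendreP (n + 1)) =
      C ((n : ℝ) + 1) * (X * legendreP (n + 1) - legendreP n) := by
  linear_combination X * X_mul_derivative_legendreP_succ n - derivative_legendreP_succ n

/-- Legendre's differential equation. -/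
theorem legendreP_ode (n : ℕ) :
    derivative ((X ^ 2 - 1) * derivative (legendreP n)) =
      C ((n : ℝ) * (n + 1)) * legendreP n := by
  cases n with
  | zero => simp [legendreP_zero]
  | succ n =>
    have h := X_mul_derivative_legendreP_succ n
    rw [legendreP_structure, derivative_C_mul, derivative_sub, derivative_mul, derivative_X]
    simp only [C_add, C_mul, C_1, map_natCast, Nat.cast_add, Nat.cast_one] at *
    linear_combination ((n : ℝ[X]) + 1) * h

theorem legendreP_eval_one (n : ℕ) : (legendreP n).eval 1 = 1 := by
  induction n using Nat.twoStepInduction with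
  | zero => simp [legendreP_zero]
  | one => simp [legendreP_one]
  | more n h0 h1 =>
    have h := legendreP_eval_recurrence n 1
    rw [h0, h1] at h
    have : (n : ℝ) + 2 ≠ 0 := by positivity
    apply mul_left_cancel₀ this
    linear_combination h

theorem legendreP_eval_neg_one (n : ℕ) : (legendreP n).eval (-1) = (-1) ^ n := by
  induction n using Nat.twoStepInduction with
  | zero => simp [legendreP_zero]
  | one => simp [legendreP_one]
  | more n h0 h1 =>
    have h := legendreP_eval_recurrence n (-1)
    rw [h0, h1] at h
    have : (n : ℝ) + 2 ≠ 0 := by positivity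
    apply mul_left_cancel₀ this
    rw [h]; ring

theorem legendreP_natDegree_le (n : ℕ) : (legendreP n).natDegree ≤ n := by
  induction n using Nat.twoStepInduction with
  | zero => simp [legendreP_zero]
  | one => simp [legendreP_one]
  | more n h0 h1 =>
    rw [legendreP]
    refine (natDegree_C_mul_le _ _).trans ((natDegree_sub_le _ _).trans (max_le ?_ ?_))
    · rw [mul_assoc]
      refine (natDegree_C_mul_le _ _).trans (natDegree_mul_le.trans ?_)
      rw [natDegree_X]; omega
    · exact (natDegree_C_mul_le _ _).trans (by omega)

theorem legendreP_coeff_self (n : ℕ) : (legendreP n).coeff n ≠ 0 := by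
  induction n with
  | zero => simp [legendreP_zero]
  | succ n ih =>
    cases n with
    | zero => simp [legendreP_one]
    | succ n =>
      have h0 : (legendreP n).coeff (n + 2) = 0 :=
        coeff_eq_zero_of_natDegree_lt ((legendreP_natDegree_le n).trans_lt (by omega))
      rw [legendreP, coeff_C_mul, coeff_sub, mul_assoc, coeff_C_mul, coeff_X_mul, coeff_C_mul, h0]
      have : (2 * (n : ℝ) + 3) ≠ 0 := by positivity
      have : ((n : ℝ) + 2) ≠ 0 := by positivity
      simp [*]

/-- Every polynomial of degree at most `n` is a Legendre polynomial multiple up to lower degree. -/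
theorem exists_sub_legendreP_degree_lt {n : ℕ} {q : ℝ[X]} (hq : q.degree < (n + 1 : ℕ)) :
    ∃ a : ℝ, (q - C a * legendreP n).degree < n := by
  refine ⟨q.coeff n / (legendreP n).coeff n, ?_⟩
  rw [degree_lt_iff_coeff_zero] at hq ⊢
  intro j hj
  rcases hj.eq_or_lt with rfl | hj
  · rw [coeff_sub, coeff_C_mul, div_mul_cancel₀ _ (legendreP_coeff_self _), sub_self]
  · rw [coeff_sub, coeff_C_mul, hq j (by omega),
      coeff_eq_zero_of_natDegree_lt ((legendreP_natDegree_le n).trans_lt hj)]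
    simp

theorem exists_sum_legendreP {n : ℕ} {q : ℝ[X]} (hq : q.degree < n) :
    ∃ a : ℕ → ℝ, q = ∑ j ∈ Finset.range n, C (a j) * legendreP j := by
  induction n generalizing q with
  | zero =>
    refine ⟨0, ?_⟩
    simpa [degree_lt_iff_coeff_zero, Polynomial.ext_iff] using hq
  | succ n ih =>
    obtain ⟨c, hc⟩ := exists_sub_legendreP_degree_lt hq
    obtain ⟨a, ha⟩ := ih hc
    refine ⟨Function.update a n c, ?_⟩
    rw [Finset.sum_range_succ, Function.update_self, ← sub_eq_iff_eq_add, ha]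
    refine Finset.sum_congr rfl fun j hj => ?_
    rw [Function.update_of_ne (Finset.mem_range.1 hj).ne]

theorem intervalIntegrable_eval (q : ℝ[X]) (a b : ℝ) :
    IntervalIntegrable (fun x => q.eval x) volume a b :=
  q.continuous.intervalIntegrable a b

theorem integral_derivative_eval (q : ℝ[X]) (a b : ℝ) :
    ∫ x in a..b, (derivative q).eval x = q.eval b - q.eval a :=
  intervalIntegral.integral_eq_sub_of_hasDerivAt (fun x _ => q.hasDerivAt x)
    (intervalIntegrable_eval _ _ _)

theorem integral_legendreP_mul_symm_aux (n : ℕ) (q : ℝ[X]) :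
    (n : ℝ) * (n + 1) * ∫ x in (-1 : ℝ)..1, (legendreP n * q).eval x =
      ∫ x in (-1 : ℝ)..1, ((1 - X ^ 2) * derivative (legendreP n) * derivative q).eval x := by
  have h := integral_derivative_eval ((X ^ 2 - 1) * derivative (legendreP n) * q) (-1) 1
  have e : derivative ((X ^ 2 - 1) * derivative (legendreP n) * q) =
      C ((n : ℝ) * (n + 1)) * (legendreP n * q)
        - (1 - X ^ 2) * derivative (legendreP n) * derivative q := by
    rw [derivative_mul, legendreP_ode]; ring
  rw [e] at h
  simp only [eval_sub _ _] at h
  rw [intervalIntegral.integral_sub (intervalIntegrable_eval _ _ _)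
    (intervalIntegrable_eval _ _ _)] at h
  simp only [eval_mul, eval_C, intervalIntegral.integral_const_mul] at h ⊢
  simp at h
  simp only [eval_sub, eval_one, eval_pow, eval_X]
  linarith

theorem integral_legendreP_mul_legendreP {n m : ℕ} (h : n ≠ m) :
    ∫ x in (-1 : ℝ)..1, (legendreP n * legendreP m).eval x = 0 := by
  have h1 := integral_legendreP_mul_symm_aux n (legendreP m)
  have h2 := integral_legendreP_mul_symm_aux m (legendreP n)
  rw [mul_right_comm (1 - X ^ 2), ← h1, mul_comm (legendreP m)] at h2
  have h3 : ((n : ℝ) - m) * (n + m + 1) ≠ 0 :=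
    mul_ne_zero (sub_ne_zero.2 (by exact_mod_cast h)) (by positivity)
  apply (mul_eq_zero.1 _).resolve_left h3
  linear_combination -h2

theorem integral_mul_legendreP_eq_zero {n : ℕ} {q : ℝ[X]} (hq : q.degree < n) :
    ∫ x in (-1 : ℝ)..1, (q * legendreP n).eval x = 0 := by
  obtain ⟨a, rfl⟩ := exists_sum_legendreP hq
  simp only [Finset.sum_mul, eval_finsetSum, mul_assoc, eval_mul (p := C _), eval_C]
  rw [intervalIntegral.integral_finsetSum
    fun j _ => (intervalIntegrable_eval _ _ _).const_mul _]
  refine Finset.sum_eq_zero fun j hj => ?_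
  rw [intervalIntegral.integral_const_mul,
    integral_legendreP_mul_legendreP (Finset.mem_range.1 hj).ne, mul_zero]

theorem integral_legendreP_sq (n : ℕ) :
    ∫ x in (-1 : ℝ)..1, (legendreP n * legendreP n).eval x = 2 / (2 * n + 1) := by
  rw [eq_div_iff (by positivity)]
  cases n with
  | zero => simp [legendreP_zero]; norm_num
  | succ n =>
    have h := integral_derivative_eval (X * (legendreP (n + 1) * legendreP (n + 1))) (-1) 1
    have e : derivative (X * (legendreP (n + 1) * legendreP (n + 1))) =
        C (2 * ((n : ℝ) + 1) + 1) * (legendreP (n + 1) * legendreP (n + 1)) +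
          C 2 * (derivative (legendreP n) * legendreP (n + 1)) := by
      have := X_mul_derivative_legendreP_succ n
      simp only [derivative_mul, derivative_X]
      simp only [C_add, C_mul, map_ofNat, C_1, map_natCast] at *
      linear_combination 2 * legendreP (n + 1) * this
    have hz : ∫ x in (-1 : ℝ)..1, (derivative (legendreP n) * legendreP (n + 1)).eval x = 0 := by
      refine integral_mul_legendreP_eq_zero ((degree_derivative_le.trans
        (degree_le_of_natDegree_le (legendreP_natDegree_le n))).trans_lt ?_)
      exact_mod_cast n.lt_succ_self
    rw [e] at h
    simp only [eval_add (p := C _ * _), eval_mul (p := C _), eval_C] at h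
    rw [intervalIntegral.integral_add ((intervalIntegrable_eval _ _ _).const_mul _)
      ((intervalIntegrable_eval _ _ _).const_mul _), intervalIntegral.integral_const_mul,
      intervalIntegral.integral_const_mul, hz] at h
    simp only [eval_mul, eval_X, legendreP_eval_one, legendreP_eval_neg_one, ← pow_add] at h ⊢
    rw [Even.neg_one_pow ⟨n + 1, rfl⟩] at h
    push_cast
    linarith

/-- A differentiable function whose derivative has the sign of `x` is largest at the endpoints. -/
theorem le_max_of_deriv_sign {F F' : ℝ → ℝ} (hF : ∀ x, HasDerivAt F (F' x) x)
    (hneg : ∀ x ∈ Icc (-1 : ℝ) 0, F' x ≤ 0) (hpos : ∀ x ∈ Icc (0 : ℝ) 1, 0 ≤ F' x)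
    {x : ℝ} (hx : x ∈ Icc (-1 : ℝ) 1) : F 0 ≤ F x ∧ F x ≤ max (F (-1)) (F 1) := by
  have hc : Continuous F := continuous_iff_continuousAt.2 fun x => (hF x).continuousAt
  have hm : MonotoneOn F (Icc 0 1) :=
    monotoneOn_of_hasDerivWithinAt_nonneg (convex_Icc _ _) hc.continuousOn
      (fun x _ => (hF x).hasDerivWithinAt) fun x hx => hpos x (interior_subset hx)
  have ha : AntitoneOn F (Icc (-1) 0) :=
    antitoneOn_of_hasDerivWithinAt_nonpos (convex_Icc _ _) hc.continuousOn
      (fun x _ => (hF x).hasDerivWithinAt) fun x hx => hneg x (interior_subset hx)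
  rcases le_total 0 x with h | h
  · exact ⟨hm ⟨le_rfl, zero_le_one⟩ ⟨h, hx.2⟩ h,
      (hm ⟨h, hx.2⟩ ⟨zero_le_one, le_rfl⟩ hx.2).trans (le_max_right _ _)⟩
  · exact ⟨ha ⟨hx.1, h⟩ ⟨by norm_num, le_rfl⟩ h,
      (ha ⟨le_rfl, by norm_num⟩ ⟨hx.1, h⟩ hx.1).trans (le_max_left _ _)⟩

theorem legendreP_ode_eval (n : ℕ) (x : ℝ) :
    (1 - x ^ 2) * (derivative (derivative (legendreP n))).eval x =
      2 * x * (derivative (legendreP n)).eval x - n * (n + 1) * (legendreP n).eval x := by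
  have h := congrArg (Polynomial.eval x) (legendreP_ode n)
  simp only [derivative_mul, derivative_sub, derivative_pow, derivative_X, derivative_one,
    eval_add, eval_mul, eval_sub, eval_pow, eval_X, eval_one, eval_C, mul_one, sub_zero,
    Nat.cast_ofNat] at h
  simp at h
  linarith

theorem abs_legendreP_le_one (n : ℕ) {x : ℝ} (hx : x ∈ Icc (-1 : ℝ) 1) :
    |(legendreP n).eval x| ≤ 1 := by
  rcases Nat.eq_zero_or_pos n with rfl | hn
  · simp [legendreP_zero]
  set N : ℝ := n * (n + 1) with hN
  have hN0 : 0 < N := by positivity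
  have key := le_max_of_deriv_sign
    (F := fun x => (legendreP n).eval x ^ 2 +
      (1 - x ^ 2) * (derivative (legendreP n)).eval x ^ 2 / N)
    (F' := fun x => 2 * x * (derivative (legendreP n)).eval x ^ 2 / N) (fun x => ?_)
    (fun x hx => ?_) (fun x hx => ?_) hx
  · have h1 := key.2
    simp only [legendreP_eval_one, legendreP_eval_neg_one, ← pow_mul, mul_comm n 2] at h1
    rw [pow_mul] at h1
    norm_num at h1
    have h2 : 0 ≤ (1 - x ^ 2) * (derivative (legendreP n)).eval x ^ 2 / N := by
      have : 0 ≤ 1 - x ^ 2 := by nlinarith [hx.1, hx.2]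
      positivity
    rw [← sq_le_one_iff_abs_le_one]
    linarith
  · have h1 := ((legendreP n).hasDerivAt x).pow 2
    have h2 := ((derivative (legendreP n)).hasDerivAt x).pow 2
    have h3 : HasDerivAt (fun x : ℝ => 1 - x ^ 2) (-(2 * x)) x := by
      simpa using (hasDerivAt_pow 2 x).const_sub 1
    refine (h1.add ((h3.mul h2).div_const N)).congr_deriv ?_
    have := legendreP_ode_eval n x
    simp only [Nat.cast_ofNat, Nat.add_one_sub_one, pow_one, Pi.pow_apply]
    field_simp
    linear_combination (derivative (legendreP n)).eval x * this
  · have : 0 ≤ (derivative (legendreP n)).eval x ^ 2 / N := by positivity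
    rw [mul_div_assoc]; nlinarith [hx.2]
  · have := hx.1
    positivity

theorem legendreP_eval_zero_sq_le (n : ℕ) : (legendreP n).eval 0 ^ 2 ≤ 1 / (n + 1) := by
  induction n using Nat.twoStepInduction with
  | zero => simp [legendreP_zero]
  | one => simp [legendreP_one]
  | more n h0 _ =>
    have h := legendreP_eval_recurrence n 0
    have h2 : (legendreP (n + 2)).eval 0 = -((n + 1) / (n + 2)) * (legendreP n).eval 0 := by
      field_simp
      linarith
    rw [h2, mul_pow, neg_sq]
    calc _ ≤ (((n : ℝ) + 1) / (n + 2)) ^ 2 * (1 / (n + 1)) := by gcongr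
      _ ≤ _ := by
        push_cast
        rw [div_pow, div_mul_div_comm, div_le_div_iff₀ (by positivity) (by positivity)]
        nlinarith [n.cast_nonneg (α := ℝ)]

/-- The antiderivative `∫_{-1}^x` of the Legendre polynomial of degree `n + 1`. -/
noncomputable def legendreAnti (n : ℕ) : ℝ[X] :=
  C ((2 * (n : ℝ) + 3)⁻¹) * (legendreP (n + 2) - legendreP n)

theorem derivative_legendreAnti (n : ℕ) : derivative (legendreAnti n) = legendreP (n + 1) := by
  have h : 2 * (n : ℝ) + 3 ≠ 0 := by positivity
  rw [legendreAnti, derivative_C_mul, derivative_legendreP_sub, ← mul_assoc, ← C_mul,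
    inv_mul_cancel₀ h, C_1, one_mul]

theorem legendreAnti_eval_one (n : ℕ) : (legendreAnti n).eval 1 = 0 := by
  simp [legendreAnti, legendreP_eval_one]

theorem legendreAnti_eval_neg_one (n : ℕ) : (legendreAnti n).eval (-1) = 0 := by
  simp [legendreAnti, legendreP_eval_neg_one, pow_add]

theorem legendreAnti_ode_eval (n : ℕ) (x : ℝ) :
    (1 - x ^ 2) * (derivative (legendreP (n + 1))).eval x =
      -(((n : ℝ) + 1) * (n + 2)) * (legendreAnti n).eval x := by
  have h1 := congrArg (Polynomial.eval x) (legendreP_structure n)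
  have h2 := legendreP_eval_recurrence n x
  simp only [eval_mul, eval_sub, eval_pow, eval_X, eval_one, eval_C] at h1
  simp only [legendreAnti, eval_mul, eval_sub, eval_C]
  field_simp
  linear_combination -(2 * (n : ℝ) + 3) * h1 + (n + 1) * h2

theorem legendreAnti_sq_le (n : ℕ) {x : ℝ} (hx : x ∈ Icc (-1 : ℝ) 1) :
    (legendreAnti n).eval x ^ 2 ≤ 8 / ((n : ℝ) + 2) ^ 3 := by
  set N : ℝ := (n + 1) * (n + 2) with hN
  have hN0 : 0 < N := by positivity
  have key := le_max_of_deriv_sign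
    (F := fun x => -((legendreAnti n).eval x ^ 2 +
      (1 - x ^ 2) * (legendreP (n + 1)).eval x ^ 2 / N))
    (F' := fun x => 2 * x * (legendreP (n + 1)).eval x ^ 2 / N) (fun x => ?_)
    (fun x hx => ?_) (fun x hx => ?_) hx
  · have h1 := key.1
    have h2 : 0 ≤ (1 - x ^ 2) * (legendreP (n + 1)).eval x ^ 2 / N := by
      have : 0 ≤ 1 - x ^ 2 := by nlinarith [hx.1, hx.2]
      positivity
    have h3 : (legendreAnti n).eval 0 ^ 2 ≤
        ((2 * (n : ℝ) + 3) ^ 2)⁻¹ * (2 * (1 / (n + 3)) + 2 * (1 / (n + 1))) := by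
      have e0 := legendreP_eval_zero_sq_le n
      have e2 := legendreP_eval_zero_sq_le (n + 2)
      push_cast at e2
      rw [legendreAnti, eval_mul, eval_C, mul_pow, inv_pow, eval_sub]
      gcongr
      have : (n : ℝ) + 3 = n + 2 + 1 := by ring
      rw [this]
      nlinarith [sq_nonneg ((legendreP (n + 2)).eval 0 + (legendreP n).eval 0)]
    have h4 : (legendreP (n + 1)).eval 0 ^ 2 / N ≤ (1 / (n + 2)) / N := by
      have := legendreP_eval_zero_sq_le (n + 1)
      push_cast at this
      rw [add_assoc, one_add_one_eq_two] at this
      gcongr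
    have h5 : ((2 * (n : ℝ) + 3) ^ 2)⁻¹ * (2 * (1 / (n + 3)) + 2 * (1 / (n + 1)))
        ≤ 4 / ((n : ℝ) + 2) ^ 3 := by
      have hn := n.cast_nonneg (α := ℝ)
      have : (2 * (1 / ((n : ℝ) + 3)) + 2 * (1 / (n + 1))) =
        4 * (n + 2) / ((n + 3) * (n + 1)) := by field_simp; ring
      rw [this, inv_mul_eq_div, div_div, div_le_div_iff₀ (by positivity) (by positivity)]
      have e : ((n : ℝ) + 2) ^ 4 ≤ ((n + 3) * (n + 1) * (2 * n + 3) ^ 2) := by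
        have := mul_nonneg hn hn
        have h3 := mul_nonneg hn this
        have h4 := mul_nonneg hn h3
        nlinarith
      nlinarith
    have h6 : (1 / ((n : ℝ) + 2)) / N ≤ 4 / ((n : ℝ) + 2) ^ 3 := by
      have hn := n.cast_nonneg (α := ℝ)
      rw [hN, div_div, div_le_div_iff₀ (by positivity) (by positivity)]
      have e : ((n : ℝ) + 2) ≤ 4 * (n + 1) := by linarith
      have := mul_le_mul_of_nonneg_right e (sq_nonneg ((n : ℝ) + 2))
      linarith
    have h7 : 8 / ((n : ℝ) + 2) ^ 3 = 4 / ((n : ℝ) + 2) ^ 3 + 4 / ((n : ℝ) + 2) ^ 3 := by ring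
    norm_num at h1
    linarith
  · have h1 := ((legendreAnti n).hasDerivAt x).pow 2
    have h2 := ((legendreP (n + 1)).hasDerivAt x).pow 2
    have h3 : HasDerivAt (fun x : ℝ => 1 - x ^ 2) (-(2 * x)) x := by
      simpa using (hasDerivAt_pow 2 x).const_sub 1
    refine (h1.add ((h3.mul h2).div_const N)).neg.congr_deriv ?_
    have := legendreAnti_ode_eval n x
    rw [derivative_legendreAnti]
    simp only [Nat.cast_ofNat, Nat.add_one_sub_one, pow_one, Pi.pow_apply]
    field_simp
    linear_combination -(legendreP (n + 1)).eval x * this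
  · have : 0 ≤ (legendreP (n + 1)).eval x ^ 2 / N := by positivity
    rw [mul_div_assoc]; nlinarith [hx.2]
  · have := hx.1
    positivity

/-! ### Riemann–Liouville integrals of polynomials -/

theorem intervalIntegrable_beta {u v a : ℝ} (hu : 0 < u) (hv : 0 < v) (ha : 0 < a) :
    IntervalIntegrable (fun x : ℝ => x ^ (u - 1) * (a - x) ^ (v - 1)) volume 0 a := by
  have hl : ∀ u v : ℝ, 0 < u →
      IntervalIntegrable (fun x : ℝ => x ^ (u - 1) * (a - x) ^ (v - 1)) volume 0 (a / 2) := by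
    intro u v hu
    refine (intervalIntegral.intervalIntegrable_rpow' (by linarith)).mul_continuousOn ?_
    refine ContinuousOn.rpow_const (by fun_prop) fun x hx => Or.inl ?_
    rw [uIcc_of_le (by positivity)] at hx
    have := hx.2
    linarith
  refine (hl u v hu).trans ?_
  have h := ((hl v u hv).comp_sub_left a).symm
  have e : a - a / 2 = a / 2 := by ring
  rw [sub_zero, e] at h
  refine h.congr (fun x _ => ?_)
  simp only [sub_sub_cancel]
  ring

theorem integral_beta {u v a : ℝ} (hu : 0 < u) (hv : 0 < v) (ha : 0 < a) :
    ∫ x in (0 : ℝ)..a, x ^ (u - 1) * (a - x) ^ (v - 1) =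
      a ^ (u + v - 1) * (Real.Gamma u * Real.Gamma v / Real.Gamma (u + v)) := by
  have h := Complex.betaIntegral_scaled u v ha
  have hG : Complex.betaIntegral u v =
      ((Real.Gamma u * Real.Gamma v / Real.Gamma (u + v) : ℝ) : ℂ) := by
    have h1 := Complex.Gamma_mul_Gamma_eq_betaIntegral (s := u) (t := v) (by simpa) (by simpa)
    rw [← Complex.ofReal_add, Complex.Gamma_ofReal, Complex.Gamma_ofReal,
      Complex.Gamma_ofReal] at h1
    have h2 : ((Real.Gamma (u + v) : ℝ) : ℂ) ≠ 0 :=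
      Complex.ofReal_ne_zero.2 (Real.Gamma_pos_of_pos (by positivity)).ne'
    rw [Complex.ofReal_div, eq_div_iff h2, Complex.ofReal_mul, h1]
    ring
  rw [hG] at h
  have hr : (a : ℂ) ^ ((u : ℂ) + v - 1) = ((a ^ (u + v - 1) : ℝ) : ℂ) := by
    rw [Complex.ofReal_cpow ha.le]; push_cast; ring_nf
  rw [hr, ← Complex.ofReal_mul] at h
  rw [← Complex.ofReal_inj, ← h, ← intervalIntegral.integral_ofReal]
  refine intervalIntegral.integral_congr fun x hx => ?_
  rw [uIcc_of_le ha.le] at hx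
  rw [Complex.ofReal_mul, Complex.ofReal_cpow hx.1, Complex.ofReal_cpow (sub_nonneg.2 hx.2)]
  push_cast
  rfl

theorem intervalIntegrable_kernel_mul_rpow {ε q s : ℝ} (hε : 0 < ε) (hq : -1 < q) (hs : -1 < s) :
    IntervalIntegrable (fun t : ℝ => (s - t) ^ (ε - 1) * (t + 1) ^ q) volume (-1) s := by
  have h := (intervalIntegrable_beta (u := q + 1) (v := ε) (a := s + 1) (by linarith) hε
    (by linarith)).comp_add_right 1
  simp only [zero_sub, add_sub_cancel_right, add_sub_add_right_eq_sub] at h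
  exact h.congr fun x _ => mul_comm _ _

theorem integral_kernel_mul_rpow {ε q s : ℝ} (hε : 0 < ε) (hq : -1 < q) (hs : -1 < s) :
    ∫ t in (-1 : ℝ)..s, (s - t) ^ (ε - 1) * (t + 1) ^ q =
      Real.Gamma ε * (Real.Gamma (q + 1) / Real.Gamma (q + ε + 1) * (s + 1) ^ (q + ε)) := by
  have h := integral_beta (u := q + 1) (v := ε) (a := s + 1) (by linarith) hε (by linarith)
  have h2 := intervalIntegral.integral_comp_add_right (a := -1) (b := s)
    (fun x : ℝ => x ^ (q + 1 - 1) * (s + 1 - x) ^ (ε - 1)) 1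
  rw [neg_add_cancel, h] at h2
  simp only [add_sub_cancel_right, add_sub_add_right_eq_sub] at h2
  simp only [mul_comm ((s - _) ^ (ε - 1))]
  rw [h2]
  have e1 : q + 1 + ε - 1 = q + ε := by ring
  have e2 : q + 1 + ε = q + ε + 1 := by ring
  rw [e1, e2]
  ring

theorem shifted_monomial_induction {P : ℝ[X] → Prop}
    (hadd : ∀ p q, P p → P q → P (p + q)) (hmon : ∀ (a : ℝ) (j : ℕ), P (C a * (X + 1) ^ j))
    (V : ℝ[X]) : P V := by
  have h : ∀ q : ℝ[X], P (taylor 1 q) := by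
    intro q
    induction q using Polynomial.induction_on' with
    | add p q hp hq => rw [map_add]; exact hadd _ _ hp hq
    | monomial n a => rw [taylor_monomial, C_1]; exact hmon a n
  simpa [taylor_taylor] using h (taylor (-1) V)

/-- The Riemann–Liouville integral of order `β` based at `-1` of the polynomial `V`. -/
noncomputable def fracInt (β : ℝ) (V : ℝ[X]) (x : ℝ) : ℝ :=
  (taylor (-1) V).sum fun j a =>
    a * (Real.Gamma (j + 1) / Real.Gamma (j + β + 1) * (x + 1) ^ ((j : ℝ) + β))

theorem fracInt_add (β : ℝ) (V W : ℝ[X]) (x : ℝ) :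
    fracInt β (V + W) x = fracInt β V x + fracInt β W x := by
  rw [fracInt, map_add, sum_add_index _ _ _ (by simp) (by intros; ring)]
  rfl

theorem fracInt_monomial (β a : ℝ) (j : ℕ) (x : ℝ) :
    fracInt β (C a * (X + 1) ^ j) x =
      a * (Real.Gamma (j + 1) / Real.Gamma (j + β + 1) * (x + 1) ^ ((j : ℝ) + β)) := by
  have h : taylor (-1) (C a * (X + 1) ^ j) = monomial j a := by
    simp [taylor_apply, C_mul_X_pow_eq_monomial]
  rw [fracInt, h, sum_monomial_index _ _ (by simp)]

theorem fracInt_C_mul (β c : ℝ) (V : ℝ[X]) (x : ℝ) :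
    fracInt β (C c * V) x = c * fracInt β V x := by
  induction V using shifted_monomial_induction with
  | hadd p q hp hq => rw [mul_add, fracInt_add, hp, hq, fracInt_add, mul_add]
  | hmon a j => rw [← mul_assoc, ← C_mul, fracInt_monomial, fracInt_monomial, mul_assoc]

theorem fracInt_sub (β : ℝ) (V W : ℝ[X]) (x : ℝ) :
    fracInt β (V - W) x = fracInt β V x - fracInt β W x := by
  have : V - W = V + C (-1) * W := by simp [sub_eq_add_neg]
  rw [this, fracInt_add, fracInt_C_mul]
  ring

theorem fracInt_zero (V : ℝ[X]) (x : ℝ) : fracInt 0 V x = V.eval x := by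
  induction V using shifted_monomial_induction with
  | hadd p q hp hq => rw [fracInt_add, hp, hq, eval_add]
  | hmon a j =>
    rw [fracInt_monomial, add_zero, div_self (Real.Gamma_pos_of_pos (by positivity)).ne',
      one_mul, Real.rpow_natCast]
    simp

theorem hasDerivAt_fracInt {β : ℝ} (hβ : -1 < β) (V : ℝ[X]) {x : ℝ} (hx : -1 < x) :
    HasDerivAt (fracInt (β + 1) V) (fracInt β V x) x := by
  induction V using shifted_monomial_induction with
  | hadd p q hp hq =>
    rw [fracInt_add]
    exact (hp.add hq).congr_of_eventuallyEq (Eventually.of_forall fun y => fracInt_add _ _ _ _)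
  | hmon a j =>
    simp only [fracInt_monomial, funext (fracInt_monomial (β + 1) a j)]
    have hj : (0 : ℝ) < j + β + 1 := by have := j.cast_nonneg (α := ℝ); linarith
    have h := ((hasDerivAt_id x).add_const 1).rpow_const (p := (j : ℝ) + (β + 1))
      (Or.inl (by simp only [id]; linarith))
    refine ((h.const_mul _).const_mul a).congr_deriv ?_
    have e : (j : ℝ) + (β + 1) + 1 = (j + β + 1) + 1 := by ring
    have e2 : (j : ℝ) + (β + 1) - 1 = j + β := by ring
    have hG := (Real.Gamma_pos_of_pos hj).ne'
    rw [e, Real.Gamma_add_one hj.ne', e2]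
    simp only [id]
    field_simp
    ring

theorem continuous_fracInt {β : ℝ} (hβ : 0 ≤ β) (V : ℝ[X]) : Continuous (fracInt β V) := by
  induction V using shifted_monomial_induction with
  | hadd p q hp hq => exact (hp.add hq).congr fun y => (fracInt_add _ _ _ _).symm
  | hmon a j =>
    simp only [funext (fracInt_monomial β a j)]
    refine continuous_const.mul (continuous_const.mul
      (Continuous.rpow_const (by fun_prop) fun x => Or.inr (by positivity)))

theorem fracInt_neg_one {β : ℝ} (hβ : 0 < β) (V : ℝ[X]) : fracInt β V (-1) = 0 := by
  induction V using shifted_monomial_induction with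
  | hadd p q hp hq => rw [fracInt_add, hp, hq, add_zero]
  | hmon a j =>
    have : (j : ℝ) + β ≠ 0 := by positivity
    rw [fracInt_monomial, neg_add_cancel, Real.zero_rpow this, mul_zero, mul_zero]

theorem fracInt_derivative (β : ℝ) (V : ℝ[X]) (x : ℝ) :
    fracInt (β + 1) (derivative V) x =
      fracInt β V x - V.eval (-1) / Real.Gamma (β + 1) * (x + 1) ^ β := by
  induction V using shifted_monomial_induction with
  | hadd p q hp hq => rw [map_add, fracInt_add, hp, hq, fracInt_add, eval_add]; ring
  | hmon a j =>
    cases j with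
    | zero =>
      have : fracInt (β + 1) 0 x = 0 := by simp [fracInt]
      rw [fracInt_monomial]
      simp [this]
      ring
    | succ j =>
      have e : derivative (C a * (X + 1) ^ (j + 1)) = C (a * (j + 1)) * (X + 1) ^ j := by
        simp [derivative_pow]
        ring
      have hG := Real.Gamma_add_one (s := (j : ℝ) + 1) (by positivity)
      rw [e, fracInt_monomial, fracInt_monomial]
      push_cast
      rw [hG]
      have e1 : (j : ℝ) + (β + 1) + 1 = j + 1 + β + 1 := by ring
      have e2 : (j : ℝ) + (β + 1) = j + 1 + β := by ring
      rw [e1, e2]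
      simp
      ring

/-- The semigroup property of the Riemann–Liouville integral, with the integrability. -/
theorem integral_kernel_mul_fracInt {ε b s : ℝ} (hε : 0 < ε) (hb : -1 < b) (hs : -1 < s)
    (V : ℝ[X]) :
    IntervalIntegrable (fun t : ℝ => (s - t) ^ (ε - 1) * fracInt b V t) volume (-1) s ∧
      ∫ t in (-1 : ℝ)..s, (s - t) ^ (ε - 1) * fracInt b V t =
        Real.Gamma ε * fracInt (b + ε) V s := by
  induction V using shifted_monomial_induction with
  | hadd p q hp hq =>
    simp only [fracInt_add, mul_add]
    exact ⟨hp.1.add hq.1, by rw [intervalIntegral.integral_add hp.1 hq.1, hp.2, hq.2]⟩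
  | hmon a j =>
    have hj : -1 < (j : ℝ) + b := by have := j.cast_nonneg (α := ℝ); linarith
    have h1 := intervalIntegrable_kernel_mul_rpow hε hj hs
    have h2 := integral_kernel_mul_rpow hε hj hs
    have e : ∀ t : ℝ, (s - t) ^ (ε - 1) * fracInt b (C a * (X + 1) ^ j) t =
        a * (Real.Gamma (j + 1) / Real.Gamma (j + b + 1)) *
          ((s - t) ^ (ε - 1) * (t + 1) ^ ((j : ℝ) + b)) := by
      intro t; rw [fracInt_monomial]; ring
    simp only [e]
    refine ⟨h1.const_mul _, ?_⟩
    have hG : Real.Gamma (j + b + 1) ≠ 0 := (Real.Gamma_pos_of_pos (by linarith)).ne'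
    rw [intervalIntegral.integral_const_mul, h2, fracInt_monomial, ← add_assoc]
    field_simp

theorem integral_kernel_mul_eval {β s : ℝ} (hβ : 0 < β) (hs : -1 < s) (V : ℝ[X]) :
    ∫ t in (-1 : ℝ)..s, (s - t) ^ (β - 1) * V.eval t = Real.Gamma β * fracInt β V s := by
  simpa [fracInt_zero] using (integral_kernel_mul_fracInt (b := 0) hβ (by norm_num) hs V).2

/-! ### Bounds for Riemann–Liouville integrals of Legendre polynomials -/

theorem integral_kernel {ε a s : ℝ} (hε : 0 < ε) :
    ∫ t in a..s, (s - t) ^ (ε - 1) = (s - a) ^ ε / ε := by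
  rw [intervalIntegral.integral_comp_sub_left (fun t => t ^ (ε - 1)), sub_self,
    integral_rpow (Or.inl (by linarith)), sub_add_cancel, Real.zero_rpow hε.ne', sub_zero]

theorem intervalIntegrable_kernel {ε a s : ℝ} (hε : 0 < ε) :
    IntervalIntegrable (fun t : ℝ => (s - t) ^ (ε - 1)) volume a s := by
  have h := (intervalIntegral.intervalIntegrable_rpow' (a := 0) (b := s - a) (r := ε - 1)
    (by linarith)).comp_sub_left s
  simpa using h.symm

theorem abs_integral_kernel_mul_le {ε a s A : ℝ} (hε : 0 < ε) (has : a ≤ s) {φ : ℝ → ℝ}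
    (hA : ∀ t ∈ Icc a s, |φ t| ≤ A) :
    |∫ t in a..s, (s - t) ^ (ε - 1) * φ t| ≤ A * ((s - a) ^ ε / ε) := by
  rw [← integral_kernel hε, ← intervalIntegral.integral_const_mul]
  refine intervalIntegral.norm_integral_le_of_norm_le (f := fun t => (s - t) ^ (ε - 1) * φ t) has
    (Eventually.of_forall fun t ht => ?_)
    ((intervalIntegrable_kernel hε).const_mul A)
  have h0 : 0 ≤ (s - t) ^ (ε - 1) := Real.rpow_nonneg (sub_nonneg.2 ht.2) _
  rw [Real.norm_eq_abs, abs_mul, abs_of_nonneg h0, mul_comm]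
  exact mul_le_mul_of_nonneg_right (hA t ⟨ht.1.le, ht.2⟩) h0

theorem abs_fracInt_interpolation {b ε A B h : ℝ} (hb : 0 ≤ b) (hε : 0 < ε) (hε1 : ε < 1)
    (hh : 0 < h) {V : ℝ[X]} (hA : ∀ t ∈ Icc (-1 : ℝ) 1, |fracInt b V t| ≤ A)
    (hB : ∀ t ∈ Icc (-1 : ℝ) 1, |fracInt (b + 1) V t| ≤ B) {s : ℝ} (hs : s ∈ Icc (-1 : ℝ) 1) :
    |fracInt (b + ε) V s| ≤ (A * (h ^ ε / ε) + 2 * B * h ^ (ε - 1)) / Real.Gamma ε := by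
  have hG := Real.Gamma_pos_of_pos hε
  have hA0 : 0 ≤ A := (abs_nonneg _).trans (hA s hs)
  have hB0 : 0 ≤ B := (abs_nonneg _).trans (hB s hs)
  rcases hs.1.eq_or_lt with rfl | hs1
  · rw [fracInt_neg_one (by positivity), abs_zero]; positivity
  obtain ⟨hint, heq⟩ := integral_kernel_mul_fracInt hε (by linarith : -1 < b) hs1 V
  have habs : |fracInt (b + ε) V s| * Real.Gamma ε =
      |∫ t in (-1 : ℝ)..s, (s - t) ^ (ε - 1) * fracInt b V t| := by
    rw [heq, abs_mul, abs_of_pos hG, mul_comm]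
  rw [le_div_iff₀ hG, habs]
  rcases le_total (s + 1) h with hsh | hsh
  · refine (abs_integral_kernel_mul_le hε hs1.le fun t ht => hA t ⟨ht.1, ht.2.trans hs.2⟩).trans ?_
    have h1 : (s - -1) ^ ε ≤ h ^ ε := Real.rpow_le_rpow (by linarith) (by linarith) hε.le
    have h2 : 0 ≤ 2 * B * h ^ (ε - 1) := by positivity
    have h3 : A * ((s - -1) ^ ε / ε) ≤ A * (h ^ ε / ε) := by gcongr
    linarith
  have hmem : s - h ∈ uIcc (-1) s := by
    rw [uIcc_of_le hs1.le]; constructor <;> linarith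
  have hi1 := hint.mono_set (uIcc_subset_uIcc left_mem_uIcc hmem)
  have hi2 := hint.mono_set (uIcc_subset_uIcc hmem right_mem_uIcc)
  rw [← intervalIntegral.integral_add_adjacent_intervals hi1 hi2]
  have hle : -1 ≤ s - h := by linarith
  have near : |∫ t in (s - h)..s, (s - t) ^ (ε - 1) * fracInt b V t| ≤ A * (h ^ ε / ε) := by
    have := abs_integral_kernel_mul_le (a := s - h) hε (by linarith) (φ := fracInt b V) (A := A)
      fun t ht => hA t ⟨by linarith [ht.1], ht.2.trans hs.2⟩
    rwa [sub_sub_cancel] at this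
  have hpos : ∀ t ∈ uIcc (-1) (s - h), s - t ≠ 0 := by
    intro t ht
    rw [uIcc_of_le hle] at ht
    have := ht.2
    linarith
  have hu : ∀ t ∈ uIcc (-1) (s - h), HasDerivAt (fun t => (s - t) ^ (ε - 1))
      ((1 - ε) * (s - t) ^ (ε - 1 - 1)) t := fun t ht => by
    refine (((hasDerivAt_id t).const_sub s).rpow_const (p := ε - 1)
      (Or.inl (hpos t ht))).congr_deriv ?_
    simp only [id]; ring
  have hu' : IntervalIntegrable (fun t => (1 - ε) * (s - t) ^ (ε - 1 - 1)) volume (-1) (s - h) :=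
    ContinuousOn.intervalIntegrable (continuousOn_const.mul
      (ContinuousOn.rpow_const (by fun_prop) fun t ht => Or.inl (hpos t ht)))
  have hcb := continuous_fracInt (by linarith : 0 ≤ b + 1) V
  have far : |∫ t in (-1 : ℝ)..(s - h), (s - t) ^ (ε - 1) * fracInt b V t| ≤
      2 * B * h ^ (ε - 1) := by
    have hparts := intervalIntegral.integral_mul_deriv_eq_deriv_mul_of_hasDerivAt
      (a := -1) (b := s - h) (u := fun t => (s - t) ^ (ε - 1)) (v := fracInt (b + 1) V)
      (u' := fun t => (1 - ε) * (s - t) ^ (ε - 1 - 1)) (v' := fracInt b V)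
      (fun t ht => (hu t ht).continuousAt.continuousWithinAt) hcb.continuousOn
      (fun t ht => hu t (Ioo_subset_Icc_self ht))
      (fun t ht => hasDerivAt_fracInt (by linarith) V
        (by rw [min_eq_left hle] at ht; exact ht.1)) hu'
      ((continuous_fracInt hb V).intervalIntegrable _ _)
    have hi : ∫ t in (-1 : ℝ)..(s - h), (1 - ε) * (s - t) ^ (ε - 1 - 1) =
        h ^ (ε - 1) - (s + 1) ^ (ε - 1) := by
      rw [intervalIntegral.integral_eq_sub_of_hasDerivAt hu hu']
      simp
    have hb1 : |∫ t in (-1 : ℝ)..(s - h), (1 - ε) * (s - t) ^ (ε - 1 - 1) * fracInt (b + 1) V t| ≤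
        B * (h ^ (ε - 1) - (s + 1) ^ (ε - 1)) := by
      rw [← hi, ← intervalIntegral.integral_const_mul]
      refine intervalIntegral.norm_integral_le_of_norm_le
        (f := fun t => (1 - ε) * (s - t) ^ (ε - 1 - 1) * fracInt (b + 1) V t) hle
        (Eventually.of_forall fun t ht => ?_) (hu'.const_mul B)
      have h0 : 0 ≤ (1 - ε) * (s - t) ^ (ε - 1 - 1) :=
        mul_nonneg (by linarith) (Real.rpow_nonneg (by linarith [ht.2]) _)
      rw [Real.norm_eq_abs, abs_mul, abs_of_nonneg h0, mul_comm]
      exact mul_le_mul_of_nonneg_right (hB t ⟨ht.1.le, by linarith [ht.2, hs.2]⟩) h0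
    have hb2 : |h ^ (ε - 1) * fracInt (b + 1) V (s - h)| ≤ B * h ^ (ε - 1) := by
      rw [abs_mul, abs_of_nonneg (by positivity), mul_comm]
      exact mul_le_mul_of_nonneg_right (hB _ ⟨hle, by linarith [hs.2]⟩) (by positivity)
    have hb3 : 0 ≤ B * (s + 1) ^ (ε - 1) :=
      mul_nonneg hB0 (Real.rpow_nonneg (by linarith) _)
    rw [fracInt_neg_one (by linarith), mul_zero, sub_zero, sub_sub_cancel] at hparts
    rw [hparts]
    refine (abs_sub _ _).trans ?_
    linarith
  exact (abs_add_le _ _).trans (by linarith)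

/-- `(n + 1)^b |I^β L_n|` is bounded on `[-1, 1]` uniformly in `n`. -/
def LegendreDecay (β b : ℝ) : Prop :=
  ∃ C : ℝ, 0 ≤ C ∧ ∀ n : ℕ, ∀ s ∈ Icc (-1 : ℝ) 1,
    |fracInt β (legendreP n) s| ≤ C * ((n : ℝ) + 1) ^ (-b)

theorem fracInt_legendreP_succ (β : ℝ) (n : ℕ) (x : ℝ) :
    fracInt (β + 1) (legendreP (n + 1)) x = fracInt β (legendreAnti n) x := by
  rw [← derivative_legendreAnti, fracInt_derivative, legendreAnti_eval_neg_one]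
  simp

theorem fracInt_legendreAnti (β : ℝ) (n : ℕ) (x : ℝ) :
    fracInt β (legendreAnti n) x =
      (2 * (n : ℝ) + 3)⁻¹ * (fracInt β (legendreP (n + 2)) x - fracInt β (legendreP n) x) := by
  rw [legendreAnti, fracInt_C_mul, fracInt_sub]

theorem exists_abs_fracInt_le {β : ℝ} (hβ : 0 ≤ β) (V : ℝ[X]) :
    ∃ M : ℝ, 0 ≤ M ∧ ∀ s ∈ Icc (-1 : ℝ) 1, |fracInt β V s| ≤ M := by
  obtain ⟨M, hM⟩ := isCompact_Icc.exists_bound_of_continuousOn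
    (continuous_fracInt hβ V).continuousOn (s := Icc (-1 : ℝ) 1)
  exact ⟨M, (norm_nonneg _).trans (hM 1 (by simp)), hM⟩

theorem legendreDecay_of_succ {β b C : ℝ} (hβ : 0 ≤ β)
    (h : ∀ n : ℕ, ∀ s ∈ Icc (-1 : ℝ) 1,
      |fracInt β (legendreP (n + 1)) s| ≤ C * ((n : ℝ) + 2) ^ (-b)) :
    LegendreDecay β b := by
  obtain ⟨M, hM0, hM⟩ := exists_abs_fracInt_le hβ (legendreP 0)
  refine ⟨max M C, le_max_of_le_left hM0, fun n s hs => ?_⟩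
  cases n with
  | zero => simpa using Or.inl (hM s hs)
  | succ n =>
    refine (h n s hs).trans ?_
    have : ((n + 1 : ℕ) : ℝ) + 1 = n + 2 := by push_cast; ring
    rw [this]
    gcongr
    exact le_max_right _ _

theorem legendreDecay_zero : LegendreDecay 0 0 :=
  ⟨1, zero_le_one, fun n s hs => by simpa [fracInt_zero] using abs_legendreP_le_one n hs⟩

theorem LegendreDecay.succ {β b : ℝ} (hβ : 0 ≤ β) (hb : 0 ≤ b) (h : LegendreDecay β b) :
    LegendreDecay (β + 1) (b + 1) := by
  obtain ⟨C, hC0, hC⟩ := h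
  refine legendreDecay_of_succ (C := 2 * C * 2 ^ b) (by linarith) fun n s hs => ?_
  rw [fracInt_legendreP_succ, fracInt_legendreAnti, abs_mul, abs_of_pos (by positivity)]
  have h1 := hC n s hs
  have h2 := hC (n + 2) s hs
  have hn : (0 : ℝ) < (n : ℝ) + 1 := by positivity
  have h3 : (((n + 2 : ℕ) : ℝ) + 1) ^ (-b) ≤ ((n : ℝ) + 1) ^ (-b) :=
    Real.rpow_le_rpow_of_nonpos hn (by push_cast; linarith) (by linarith)
  have h4 : ((n : ℝ) + 1) ^ (-b) ≤ 2 ^ b * ((n : ℝ) + 2) ^ (-b) := by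
    have : ((n : ℝ) + 1) ^ (-b) ≤ (((n : ℝ) + 2) / 2) ^ (-b) :=
      Real.rpow_le_rpow_of_nonpos (by positivity) (by linarith) (by linarith)
    rwa [Real.div_rpow (by positivity) zero_le_two, Real.rpow_neg zero_le_two b, div_inv_eq_mul,
      mul_comm] at this
  have h5 : |fracInt β (legendreP (n + 2)) s - fracInt β (legendreP n) s| ≤
      2 * C * (2 ^ b * ((n : ℝ) + 2) ^ (-b)) := by
    refine (abs_sub _ _).trans ?_
    have := mul_le_mul_of_nonneg_left h3 hC0
    have := mul_le_mul_of_nonneg_left h4 hC0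
    linarith
  have h6 : (2 * (n : ℝ) + 3)⁻¹ ≤ ((n : ℝ) + 2)⁻¹ := by gcongr <;> linarith
  have h7 : ((n : ℝ) + 2) ^ (-(b + 1)) = ((n : ℝ) + 2) ^ (-b) * ((n : ℝ) + 2)⁻¹ := by
    rw [neg_add, Real.rpow_add (by positivity), Real.rpow_neg_one]
  rw [h7]
  calc _ ≤ ((n : ℝ) + 2)⁻¹ * (2 * C * (2 ^ b * ((n : ℝ) + 2) ^ (-b))) := by gcongr
    _ = _ := by ring

theorem legendreDecay_one : LegendreDecay 1 (3 / 2) := by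
  refine legendreDecay_of_succ (C := 3) zero_le_one fun n s hs => ?_
  have h := fracInt_legendreP_succ 0 n s
  rw [zero_add, fracInt_zero] at h
  rw [h]
  refine abs_le_of_sq_le_sq (b := 3 * ((n : ℝ) + 2) ^ (-(3 / 2) : ℝ)) ?_ (by positivity)
  refine (legendreAnti_sq_le n hs).trans ?_
  have : (((n : ℝ) + 2) ^ (-(3 / 2) : ℝ)) ^ 2 = (((n : ℝ) + 2) ^ 3)⁻¹ := by
    rw [← Real.rpow_natCast, ← Real.rpow_mul (by positivity), ← Real.rpow_natCast,
      ← Real.rpow_neg (by positivity)]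
    norm_num
  rw [mul_pow, this, div_eq_mul_inv]
  gcongr
  norm_num

theorem LegendreDecay.interpolate {β b ε : ℝ} (hβ : 0 ≤ β) (hε : 0 < ε) (hε1 : ε < 1)
    (h0 : LegendreDecay β b) (h1 : LegendreDecay (β + 1) (b + 1)) :
    LegendreDecay (β + ε) (b + ε) := by
  obtain ⟨A, hA0, hA⟩ := h0
  obtain ⟨B, hB0, hB⟩ := h1
  have hG := Real.Gamma_pos_of_pos hε
  refine ⟨(A / ε + 2 * B) / Real.Gamma ε, by positivity, fun n s hs => ?_⟩
  have hn : (0 : ℝ) < (n : ℝ) + 1 := by positivity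
  refine (abs_fracInt_interpolation hβ hε hε1 (inv_pos.2 hn) (hA n) (hB n) hs).trans_eq ?_
  have e1 : ((n : ℝ) + 1)⁻¹ ^ ε = ((n : ℝ) + 1) ^ (-ε) := by
    rw [Real.inv_rpow hn.le, Real.rpow_neg hn.le]
  have e2 : ((n : ℝ) + 1)⁻¹ ^ (ε - 1) = ((n : ℝ) + 1) ^ (1 - ε) := by
    rw [Real.inv_rpow hn.le, ← Real.rpow_neg hn.le, neg_sub]
  have e3 : ((n : ℝ) + 1) ^ (-(b + ε)) = ((n : ℝ) + 1) ^ (-b) * ((n : ℝ) + 1) ^ (-ε) := by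
    rw [← Real.rpow_add hn]; ring_nf
  have e4 : ((n : ℝ) + 1) ^ (-(b + ε)) = ((n : ℝ) + 1) ^ (-(b + 1)) * ((n : ℝ) + 1) ^ (1 - ε) := by
    rw [← Real.rpow_add hn]; ring_nf
  rw [e1, e2, div_mul_eq_mul_div]
  congr 1
  rw [add_mul]
  nth_rewrite 1 [e3]
  rw [e4]
  ring

theorem LegendreDecay.add_nat {β b : ℝ} (hβ : 0 ≤ β) (hb : 0 ≤ b) (h : LegendreDecay β b)
    (N : ℕ) : LegendreDecay (β + N) (b + N) := by
  induction N with
  | zero => simpa using h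
  | succ N ih =>
    have := LegendreDecay.succ (by positivity) (by positivity) ih
    push_cast
    rwa [← add_assoc, ← add_assoc]

theorem LegendreDecay.add {β b γ : ℝ} (hβ : 0 ≤ β) (hb : 0 ≤ b) (h : LegendreDecay β b)
    (hγ : 0 ≤ γ) : LegendreDecay (β + γ) (b + γ) := by
  have h0 := h.add_nat hβ hb ⌊γ⌋₊
  rcases (Nat.floor_le hγ).eq_or_lt with he | hlt
  · rwa [he] at h0
  have h2 := Nat.lt_floor_add_one γ
  have := LegendreDecay.interpolate (ε := γ - ⌊γ⌋₊) (by positivity) (by linarith) (by linarith) h0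
    (h0.succ (by positivity) (by positivity))
  simpa [add_assoc] using this

theorem legendreDecay_self {β : ℝ} (hβ : 0 ≤ β) : LegendreDecay β β := by
  simpa using legendreDecay_zero.add le_rfl le_rfl hβ

theorem legendreDecay_add_half {β : ℝ} (hβ : 1 ≤ β) : LegendreDecay β (β + 1 / 2) := by
  have := legendreDecay_one.add zero_le_one (by norm_num) (sub_nonneg.2 hβ)
  convert this using 1 <;> ring

theorem fracInt_legendreP_one_recurrence {β : ℝ} (hβ : 0 < β) (n : ℕ) :
    ((n : ℝ) + 1 + β) * fracInt β (legendreP (n + 1)) 1 =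
      ((n : ℝ) + 1 - β) * fracInt β (legendreP n) 1 := by
  have hG := (Real.Gamma_pos_of_pos hβ).ne'
  have key : ∫ t in (-1 : ℝ)..1, (1 - t) ^ (β - 1) *
        ((X - 1) * derivative (legendreP (n + 1) + legendreP n)).eval t =
      -(∫ t in (-1 : ℝ)..1, (1 - t) ^ (β + 1 - 1) *
        (derivative (legendreP (n + 1) + legendreP n)).eval t) := by
    rw [← intervalIntegral.integral_neg]
    refine intervalIntegral.integral_congr fun t ht => ?_
    rw [uIcc_of_le (by norm_num)] at ht
    have : (1 - t) ^ (β + 1 - 1) = (1 - t) ^ (β - 1) * (1 - t) := by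
      rw [← Real.rpow_add_one' (by linarith [ht.2]) (by linarith), sub_add_cancel,
        add_sub_cancel_right]
    simp only [this, eval_mul, eval_sub, eval_X, eval_one]
    ring
  rw [legendreP_jacobi_identity, integral_kernel_mul_eval hβ (by norm_num),
    integral_kernel_mul_eval (by linarith) (by norm_num), fracInt_derivative, fracInt_C_mul,
    fracInt_sub, fracInt_add, eval_add, legendreP_eval_neg_one, legendreP_eval_neg_one,
    Real.Gamma_add_one hβ.ne', pow_succ] at key
  have : Real.Gamma β * (((n : ℝ) + 1 + β) * fracInt β (legendreP (n + 1)) 1) =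
      Real.Gamma β * (((n : ℝ) + 1 - β) * fracInt β (legendreP n) 1) := by
    ring_nf at key ⊢
    linarith
  exact mul_left_cancel₀ hG this

theorem exists_bound_of_eventually_antitone {b : ℕ → ℝ} (hb : ∀ n, 0 ≤ b n) {N : ℕ}
    (h : ∀ n ≥ N, b (n + 1) ≤ b n) : ∃ M, 0 ≤ M ∧ ∀ n, b n ≤ M := by
  refine ⟨∑ i ∈ Finset.range (N + 1), b i, Finset.sum_nonneg fun i _ => hb i, fun n => ?_⟩
  have hle : ∀ n ≤ N, b n ≤ ∑ i ∈ Finset.range (N + 1), b i := fun n hn =>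
    Finset.single_le_sum (fun i _ => hb i) (Finset.mem_range.2 (by omega))
  rcases le_total n N with hn | hn
  · exact hle n hn
  · induction n, hn using Nat.le_induction with
    | base => exact hle N le_rfl
    | succ n hn ih => exact (h n hn).trans ih

theorem sub_div_add_le_rpow {β x : ℝ} (hβ : 0 < β) (hx : 0 < x) :
    (x - β) / (x + β) ≤ ((x + β) / (x + β + 1)) ^ (2 * β) := by
  have hy : 0 < x + β := by positivity
  have h1 : (x - β) / (x + β) = -(2 * β / (x + β)) + 1 := by field_simp; ring
  have h2 : -(x + β)⁻¹ ≤ Real.log ((x + β) / (x + β + 1)) := by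
    have := Real.one_sub_inv_le_log_of_pos (x := (x + β) / (x + β + 1)) (by positivity)
    refine le_trans (le_of_eq ?_) this
    field_simp
    ring
  rw [h1, Real.rpow_def_of_pos (by positivity)]
  refine (Real.add_one_le_exp _).trans (Real.exp_le_exp.2 ?_)
  have := mul_le_mul_of_nonneg_right h2 (by positivity : 0 ≤ 2 * β)
  refine le_trans (le_of_eq ?_) this
  ring

theorem exists_abs_fracInt_legendreP_one_le {β : ℝ} (hβ : 0 < β) :
    ∃ C : ℝ, 0 ≤ C ∧ ∀ n : ℕ, |fracInt β (legendreP n) 1| ≤ C * ((n : ℝ) + 1) ^ (-(2 * β)) := by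
  obtain ⟨M, hM0, hM⟩ := exists_bound_of_eventually_antitone
    (b := fun n : ℕ => |fracInt β (legendreP n) 1| * ((n : ℝ) + 1 + β) ^ (2 * β))
    (fun n => by positivity) (N := ⌈β⌉₊) fun n hn => by
      have hn' : β ≤ n := Nat.ceil_le.1 hn
      have hrec := fracInt_legendreP_one_recurrence hβ n
      have hpos : 0 < (n : ℝ) + 1 + β := by positivity
      have h1 : |fracInt β (legendreP (n + 1)) 1| =
          ((n : ℝ) + 1 - β) / ((n : ℝ) + 1 + β) * |fracInt β (legendreP n) 1| := by
        have : fracInt β (legendreP (n + 1)) 1 =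
            ((n : ℝ) + 1 - β) / ((n : ℝ) + 1 + β) * fracInt β (legendreP n) 1 := by
          field_simp
          linarith
        rw [this, abs_mul, abs_of_nonneg (div_nonneg (by linarith) hpos.le)]
      have h2 := sub_div_add_le_rpow hβ (by positivity : 0 < (n : ℝ) + 1)
      rw [Real.div_rpow hpos.le (by positivity), le_div_iff₀ (by positivity)] at h2
      have h3 : ((n + 1 : ℕ) : ℝ) + 1 + β = n + 1 + β + 1 := by push_cast; ring
      simp only [h1, h3]
      calc _ = |fracInt β (legendreP n) 1| * (((n : ℝ) + 1 - β) / ((n : ℝ) + 1 + β) *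
            ((n : ℝ) + 1 + β + 1) ^ (2 * β)) := by ring
        _ ≤ _ := by gcongr
  refine ⟨M, hM0, fun n => ?_⟩
  have hn : (0 : ℝ) < (n : ℝ) + 1 := by positivity
  rw [Real.rpow_neg hn.le, ← div_eq_mul_inv, le_div_iff₀ (by positivity)]
  exact le_trans (mul_le_mul_of_nonneg_left
    (Real.rpow_le_rpow hn.le (by linarith) (by positivity)) (abs_nonneg _)) (hM n)

theorem exists_abs_fracInt_legendreP_one_sub_le {β : ℝ} (hβ : 0 < β) :
    ∃ C : ℝ, 0 ≤ C ∧ ∀ n : ℕ,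
      |fracInt β (legendreP (n + 1)) 1 - fracInt β (legendreP n) 1| ≤
        C * ((n : ℝ) + 1) ^ (-(2 * β + 1)) := by
  obtain ⟨C, hC0, hC⟩ := exists_abs_fracInt_legendreP_one_le hβ
  refine ⟨2 * β * C, by positivity, fun n => ?_⟩
  have hn : (0 : ℝ) < (n : ℝ) + 1 := by positivity
  have hrec := fracInt_legendreP_one_recurrence hβ n
  have h1 : fracInt β (legendreP (n + 1)) 1 - fracInt β (legendreP n) 1 =
      -(2 * β / ((n : ℝ) + 1 + β) * fracInt β (legendreP n) 1) := by
    field_simp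
    linarith
  rw [h1, abs_neg, abs_mul, abs_of_nonneg (by positivity), neg_add, Real.rpow_add hn,
    Real.rpow_neg_one]
  calc _ ≤ 2 * β / ((n : ℝ) + 1) * (C * ((n : ℝ) + 1) ^ (-(2 * β))) := by
        refine mul_le_mul (div_le_div_of_nonneg_left (by positivity) hn (by linarith)) (hC n)
          (abs_nonneg _) (by positivity)
    _ = _ := by ring

/-! ### Fubini and integration by parts -/

theorem measurable_fracInt (β : ℝ) (V : ℝ[X]) : Measurable (fracInt β V) := by
  induction V using shifted_monomial_induction with
  | hadd p q hp hq => simp only [funext (fracInt_add β p q)]; exact hp.add hq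
  | hmon a j => simp only [funext (fracInt_monomial β a j)]; fun_prop

theorem intervalIntegrable_fracInt {b s : ℝ} (hb : -1 < b) (hs : -1 < s) (V : ℝ[X]) :
    IntervalIntegrable (fracInt b V) volume (-1) s := by
  simpa using (integral_kernel_mul_fracInt (ε := 1) one_pos hb hs V).1

theorem exists_integral_abs_kernel_mul_fracInt_le {ε b : ℝ} (hε : 0 < ε) (hb : -1 < b)
    (hbε : 0 ≤ b + ε) (V : ℝ[X]) :
    ∃ M, ∀ y ∈ Ioc (-1 : ℝ) 1, ∫ x in (-1 : ℝ)..y, |(y - x) ^ (ε - 1) * fracInt b V x| ≤ M := by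
  induction V using shifted_monomial_induction with
  | hadd p q hp hq =>
    obtain ⟨M, hM⟩ := hp
    obtain ⟨N, hN⟩ := hq
    refine ⟨M + N, fun y hy => ?_⟩
    have h1 := (integral_kernel_mul_fracInt hε hb hy.1 p).1.abs
    have h2 := (integral_kernel_mul_fracInt hε hb hy.1 q).1.abs
    have h3 := (integral_kernel_mul_fracInt hε hb hy.1 (p + q)).1.abs
    refine le_trans ?_ (add_le_add (hM y hy) (hN y hy))
    rw [← intervalIntegral.integral_add h1 h2]
    refine intervalIntegral.integral_mono_on hy.1.le h3 (h1.add h2) fun x _ => ?_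
    rw [fracInt_add, mul_add]
    exact abs_add_le _ _
  | hmon a j =>
    refine ⟨|a * (Real.Gamma (j + 1) / Real.Gamma (j + b + 1))| *
      (Real.Gamma ε * (Real.Gamma (j + b + 1) / Real.Gamma (j + b + ε + 1) *
        2 ^ ((j : ℝ) + b + ε))), fun y hy => ?_⟩
    have hj : -1 < (j : ℝ) + b := by linarith [Nat.cast_nonneg (α := ℝ) j]
    have heq : ∫ x in (-1 : ℝ)..y, |(y - x) ^ (ε - 1) * fracInt b (C a * (X + 1) ^ j) x| =
        ∫ x in (-1 : ℝ)..y, |a * (Real.Gamma (j + 1) / Real.Gamma (j + b + 1))| *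
          ((y - x) ^ (ε - 1) * (x + 1) ^ ((j : ℝ) + b)) := by
      refine intervalIntegral.integral_congr fun x hx => ?_
      rw [uIcc_of_le hy.1.le] at hx
      have h1 : 0 ≤ (y - x) ^ (ε - 1) := Real.rpow_nonneg (by linarith [hx.2]) _
      have h2 : 0 ≤ (x + 1) ^ ((j : ℝ) + b) := Real.rpow_nonneg (by linarith [hx.1]) _
      simp only [fracInt_monomial]
      rw [abs_mul, abs_mul, abs_mul, abs_of_nonneg h1, abs_of_nonneg h2, abs_mul]
      ring
    rw [heq, intervalIntegral.integral_const_mul, integral_kernel_mul_rpow hε hj hy.1]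
    have g1 : 0 < Real.Gamma (j + b + 1) := Real.Gamma_pos_of_pos (by linarith)
    have g2 : 0 < Real.Gamma (j + b + ε + 1) := Real.Gamma_pos_of_pos (by linarith)
    have g3 := Real.Gamma_pos_of_pos hε
    have : (y + 1) ^ ((j : ℝ) + b + ε) ≤ 2 ^ ((j : ℝ) + b + ε) :=
      Real.rpow_le_rpow (by linarith [hy.1]) (by linarith [hy.2])
        (by linarith [Nat.cast_nonneg (α := ℝ) j])
    gcongr

theorem integral_kernel_swap {ε M : ℝ} {φ D : ℝ → ℝ} (hφ : Measurable φ)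
    (hD : IntervalIntegrable D volume (-1) 1)
    (hint : ∀ y ∈ Ioc (-1 : ℝ) 1,
      IntervalIntegrable (fun x => (y - x) ^ (ε - 1) * φ x) volume (-1) y)
    (hM : ∀ y ∈ Ioc (-1 : ℝ) 1, ∫ x in (-1 : ℝ)..y, |(y - x) ^ (ε - 1) * φ x| ≤ M) :
    ∫ x in (-1 : ℝ)..1, (∫ y in x..1, (y - x) ^ (ε - 1) * D y) * φ x =
      ∫ y in (-1 : ℝ)..1, D y * ∫ x in (-1 : ℝ)..y, (y - x) ^ (ε - 1) * φ x := by
  set μ := volume.restrict (Ioc (-1 : ℝ) 1) with hμ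
  have hle : (-1 : ℝ) ≤ 1 := by norm_num
  rw [intervalIntegrable_iff_integrableOn_Ioc_of_le hle] at hD
  set K : ℝ → ℝ → ℝ := fun x y => (Iio y).indicator (fun x => (y - x) ^ (ε - 1) * φ x) x * D y
    with hK
  have hslice : ∀ y ∈ Ioc (-1 : ℝ) 1, ∀ g : ℝ → ℝ,
      ∫ x, (Iio y).indicator g x ∂μ = ∫ x in (-1 : ℝ)..y, g x := by
    intro y hy g
    rw [hμ, setIntegral_indicator measurableSet_Iio, intervalIntegral.integral_of_le hy.1.le,
      integral_Ioc_eq_integral_Ioo]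
    congr 2
    ext x
    simp only [mem_inter_iff, mem_Ioc, mem_Iio, mem_Ioo]
    exact ⟨fun h => ⟨h.1.1, h.2⟩, fun h => ⟨⟨h.1, h.2.le.trans hy.2⟩, h.2⟩⟩
  have hmeas : AEStronglyMeasurable (Function.uncurry K) (μ.prod μ) := by
    refine AEStronglyMeasurable.mul (f := fun z : ℝ × ℝ =>
      (Iio z.2).indicator (fun x => (z.2 - x) ^ (ε - 1) * φ x) z.1) ?_
      (AEStronglyMeasurable.comp_snd hD.aestronglyMeasurable)
    refine Measurable.aestronglyMeasurable ?_
    have : (fun z : ℝ × ℝ => (Iio z.2).indicator (fun x => (z.2 - x) ^ (ε - 1) * φ x) z.1) =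
        {z : ℝ × ℝ | z.1 < z.2}.indicator (fun z => (z.2 - z.1) ^ (ε - 1) * φ z.1) := by
      ext z
      simp only [indicator, mem_Iio, mem_ofPred_eq]
    rw [this]
    exact Measurable.indicator (by fun_prop) (measurableSet_lt measurable_fst measurable_snd)
  have hnorm : ∀ y ∈ Ioc (-1 : ℝ) 1, ∫ x, ‖K x y‖ ∂μ =
      (∫ x in (-1 : ℝ)..y, |(y - x) ^ (ε - 1) * φ x|) * |D y| := by
    intro y hy
    simp only [hK, norm_mul, norm_indicator_eq_indicator_norm, Real.norm_eq_abs]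
    rw [integral_mul_const, hslice y hy]
    simp only [abs_mul]
  have hKint : Integrable (Function.uncurry K) (μ.prod μ) := by
    rw [integrable_prod_iff' hmeas]
    constructor
    · refine (ae_restrict_iff' measurableSet_Ioc).2 (Eventually.of_forall fun y hy => ?_)
      refine Integrable.mul_const ?_ (D y)
      change Integrable ((Iio y).indicator fun x => (y - x) ^ (ε - 1) * φ x) μ
      rw [integrable_indicator_iff measurableSet_Iio, IntegrableOn, hμ,
        Measure.restrict_restrict measurableSet_Iio]
      have := (intervalIntegrable_iff_integrableOn_Ioc_of_le hy.1.le).1 (hint y hy)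
      exact this.mono_set fun x hx => ⟨hx.2.1, le_of_lt hx.1⟩
    · refine Integrable.mono' (hD.norm.const_mul M) ?_ ?_
      · exact hmeas.norm.prod_swap.integral_prod_right'
      · refine (ae_restrict_iff' measurableSet_Ioc).2 (Eventually.of_forall fun y hy => ?_)
        have := hnorm y hy
        simp only [Function.uncurry_apply_pair] at this ⊢
        rw [Real.norm_of_nonneg (integral_nonneg fun _ => norm_nonneg _), this]
        exact mul_le_mul_of_nonneg_right (hM y hy) (abs_nonneg _)
  have hswap := integral_integral_swap hKint
  rw [intervalIntegral.integral_of_le hle, intervalIntegral.integral_of_le hle]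
  refine Eq.trans ?_ (hswap.trans ?_)
  · refine setIntegral_congr_fun measurableSet_Ioc fun x hx => ?_
    have : ∀ y, K x y = (Ioi x).indicator (fun y => (y - x) ^ (ε - 1) * D y) y * φ x := by
      intro y
      simp only [hK, indicator, mem_Iio, mem_Ioi]
      split_ifs <;> ring
    simp only [this]
    rw [integral_mul_const, hμ, setIntegral_indicator measurableSet_Ioi,
      intervalIntegral.integral_of_le hx.2]
    congr 3
    ext y
    simp only [mem_inter_iff, mem_Ioc, mem_Ioi]
    exact ⟨fun h => ⟨⟨hx.1.trans h.1, h.2⟩, h.1⟩, fun h => ⟨h.2, h.1.2⟩⟩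
  · refine setIntegral_congr_fun measurableSet_Ioc fun y hy => ?_
    simp only [hK]
    rw [integral_mul_const, hslice y hy, mul_comm]

theorem exists_continuousOn_eqOn_Ioo {f f' : ℝ → ℝ}
    (hf : ∀ x ∈ Ioo (-1 : ℝ) 1, HasDerivAt f (f' x) x)
    (hf' : IntervalIntegrable f' volume (-1) 1) :
    ∃ F : ℝ → ℝ, ContinuousOn F (Icc (-1) 1) ∧ EqOn F f (Ioo (-1) 1) := by
  have hle : (-1 : ℝ) ≤ 1 := by norm_num
  have h0 : (0 : ℝ) ∈ uIcc (-1 : ℝ) 1 := by rw [uIcc_of_le hle]; norm_num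
  refine ⟨fun x => f 0 + ∫ t in (0 : ℝ)..x, f' t, ?_, fun x hx => ?_⟩
  · have := intervalIntegral.continuousOn_primitive_interval' hf' h0
    rw [uIcc_of_le hle] at this
    exact continuousOn_const.add this
  · have hsub : uIcc 0 x ⊆ Ioo (-1 : ℝ) 1 :=
      ordConnected_Ioo.uIcc_subset (by norm_num) hx
    have hint : IntervalIntegrable f' volume 0 x :=
      hf'.mono_set (uIcc_subset_uIcc h0 (by rw [uIcc_of_le hle]; exact Ioo_subset_Icc_self hx))
    simp only
    rw [intervalIntegral.integral_eq_sub_of_hasDerivAt (fun t ht => hf t (hsub ht)) hint]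
    ring

theorem exists_tendsto_left_of_hasDerivAt {f f' : ℝ → ℝ}
    (hf : ∀ x ∈ Ioo (-1 : ℝ) 1, HasDerivAt f (f' x) x)
    (hf' : IntervalIntegrable f' volume (-1) 1) :
    ∃ ℓ, Tendsto f (nhdsWithin 1 (Iio 1)) (nhds ℓ) := by
  obtain ⟨F, hF, hFf⟩ := exists_continuousOn_eqOn_Ioo hf hf'
  have hnhds : nhdsWithin (1 : ℝ) (Ioo (-1) 1) = nhdsWithin 1 (Iio 1) :=
    nhdsWithin_Ioo_eq_nhdsLT (by norm_num)
  refine ⟨F 1, ?_⟩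
  rw [← hnhds]
  exact (((hF 1 (by simp)).mono Ioo_subset_Icc_self).tendsto).congr'
    (eventually_nhdsWithin_of_forall hFf)

theorem integral_mul_deriv_eq_of_tendsto {f f' g g' : ℝ → ℝ} {ℓ : ℝ}
    (hf : ∀ x ∈ Ioo (-1 : ℝ) 1, HasDerivAt f (f' x) x)
    (hf' : IntervalIntegrable f' volume (-1) 1)
    (hg : ContinuousOn g (Icc (-1) 1))
    (hgg' : ∀ x ∈ Ioo (-1 : ℝ) 1, HasDerivAt g (g' x) x)
    (hg' : IntervalIntegrable g' volume (-1) 1)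
    (hg0 : g (-1) = 0) (hℓ : Tendsto f (nhdsWithin 1 (Iio 1)) (nhds ℓ)) :
    ∫ x in (-1 : ℝ)..1, f x * g' x = ℓ * g 1 - ∫ x in (-1 : ℝ)..1, f' x * g x := by
  have hle : (-1 : ℝ) ≤ 1 := by norm_num
  obtain ⟨F, hF, hFf⟩ := exists_continuousOn_eqOn_Ioo hf hf'
  have hnhds : nhdsWithin (1 : ℝ) (Ioo (-1) 1) = nhdsWithin 1 (Iio 1) :=
    nhdsWithin_Ioo_eq_nhdsLT (by norm_num)
  have hF1 : F 1 = ℓ := by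
    have h1 := ((hF 1 (by simp)).mono Ioo_subset_Icc_self).tendsto.congr'
      (eventually_nhdsWithin_of_forall hFf)
    rw [hnhds] at h1
    exact tendsto_nhds_unique h1 hℓ
  have hparts := intervalIntegral.integral_mul_deriv_eq_deriv_mul_of_hasDerivAt
    (a := -1) (b := 1) (u := F) (v := g) (u' := f') (v' := g')
    (by rwa [uIcc_of_le hle]) (by rwa [uIcc_of_le hle])
    (fun x hx => by
      rw [min_eq_left hle, max_eq_right hle] at hx
      exact (hf x hx).congr_of_eventuallyEq
        (Filter.eventuallyEq_of_mem (isOpen_Ioo.mem_nhds hx) hFf))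
    (fun x hx => by
      rw [min_eq_left hle, max_eq_right hle] at hx
      exact hgg' x hx) hf' hg'
  rw [hg0, mul_zero, sub_zero, hF1] at hparts
  rw [← hparts]
  exact intervalIntegral.integral_congr_Ioo_of_le hle fun x hx => by simp only [hFf hx]

theorem integral_mul_deriv_eq_neg {f f' g g' : ℝ → ℝ}
    (hf : ∀ x ∈ Ioo (-1 : ℝ) 1, HasDerivAt f (f' x) x)
    (hf' : IntervalIntegrable f' volume (-1) 1)
    (hg : ContinuousOn g (Icc (-1) 1))
    (hgg' : ∀ x ∈ Ioo (-1 : ℝ) 1, HasDerivAt g (g' x) x)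
    (hg' : IntervalIntegrable g' volume (-1) 1) (hg0 : g (-1) = 0) (hg1 : g 1 = 0) :
    ∫ x in (-1 : ℝ)..1, f x * g' x = -∫ x in (-1 : ℝ)..1, f' x * g x := by
  obtain ⟨ℓ, hℓ⟩ := exists_tendsto_left_of_hasDerivAt hf hf'
  rw [integral_mul_deriv_eq_of_tendsto hf hf' hg hgg' hg' hg0 hℓ, hg1, mul_zero, zero_sub]

theorem fracInt_nat_one_eq_zero {N i : ℕ} {V : ℝ[X]}
    (hV : ∀ q : ℝ[X], q.degree < N → ∫ x in (-1 : ℝ)..1, (q * V).eval x = 0) (hi : i < N) :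
    fracInt ((i : ℝ) + 1) V 1 = 0 := by
  have hdeg : ((1 - X : ℝ[X]) ^ i).degree < N := by
    refine lt_of_le_of_lt (degree_pow_le _ _) ?_
    have h1 : (1 - X : ℝ[X]).degree ≤ 1 :=
      (degree_sub_le _ _).trans (max_le (degree_one_le.trans zero_le_one) degree_X_le)
    calc i • (1 - X : ℝ[X]).degree ≤ i • (1 : WithBot ℕ) := nsmul_le_nsmul_right h1 i
      _ = (i : WithBot ℕ) := by simp
      _ < N := by exact_mod_cast hi
  have h := integral_kernel_mul_eval (β := (i : ℝ) + 1) (s := 1) (by positivity) (by norm_num) V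
  have h2 : ∫ t in (-1 : ℝ)..1, (1 - t) ^ ((i : ℝ) + 1 - 1) * V.eval t = 0 := by
    rw [← hV _ hdeg]
    simp [Real.rpow_natCast]
  rw [h2] at h
  exact (mul_eq_zero.1 h.symm).resolve_left (Real.Gamma_pos_of_pos (by positivity)).ne'

theorem integral_deriv_mul_eq_iterate {D : ℕ → ℝ → ℝ} {k : ℕ} {V : ℝ[X]}
    (hD : ∀ i ≤ k, ∀ x ∈ Ioo (-1 : ℝ) 1, HasDerivAt (D i) (D (i + 1) x) x)
    (hDi : ∀ i ≤ k + 1, IntervalIntegrable (D i) volume (-1) 1)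
    (hV : ∀ q : ℝ[X], q.degree < k → ∫ x in (-1 : ℝ)..1, (q * V).eval x = 0)
    {i : ℕ} (hi : i ≤ k) :
    ∫ x in (-1 : ℝ)..1, D 1 x * V.eval x =
      (-1) ^ i * ∫ x in (-1 : ℝ)..1, D (i + 1) x * fracInt i V x := by
  induction i with
  | zero => simp [fracInt_zero]
  | succ i ih =>
    have h := integral_mul_deriv_eq_neg (hD (i + 1) hi) (hDi (i + 1 + 1) (by omega))
      (continuous_fracInt (β := (i : ℝ) + 1) (by positivity) V).continuousOn
      (fun x hx => hasDerivAt_fracInt (by linarith [Nat.cast_nonneg (α := ℝ) i]) V hx.1)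
      ((continuous_fracInt (by positivity) V).intervalIntegrable _ _)
      (fracInt_neg_one (by positivity) V) (fracInt_nat_one_eq_zero hV hi)
    rw [ih (by omega), h]
    push_cast
    ring

theorem integral_deriv_mul_eq_caputoR {k m : ℕ} {α : ℝ} {ω : ℝ → ℝ} {L : ℕ → ℝ}
    (hα1 : (k : ℝ) < α) (hα2 : α < (k : ℝ) + 1)
    (hω : MemUR (k + 1) m α ω L) {V : ℝ[X]}
    (hV : ∀ q : ℝ[X], q.degree < k → ∫ x in (-1 : ℝ)..1, (q * V).eval x = 0) :
    ∫ x in (-1 : ℝ)..1, iteratedDeriv 1 ω x * V.eval x =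
      -∫ x in (-1 : ℝ)..1, caputoR (k + 1) α 1 ω x * fracInt (α - 1) V x := by
  have hk := Nat.cast_nonneg (α := ℝ) k
  obtain ⟨-, hD, hDi, -⟩ := hω
  rw [integral_deriv_mul_eq_iterate (D := fun i => iteratedDeriv i ω)
    (fun i hi => hD i (by omega)) hDi hV le_rfl]
  have hε : 0 < ((k + 1 : ℕ) : ℝ) - α := by push_cast; linarith
  have hb : -1 < α - 1 := by linarith
  obtain ⟨M, hM⟩ := exists_integral_abs_kernel_mul_fracInt_le hε hb (by push_cast; linarith) V
  have hG := (Real.Gamma_pos_of_pos hε).ne'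
  have hswap := integral_kernel_swap (measurable_fracInt (α - 1) V) (hDi (k + 1) le_rfl)
    (fun y hy => (integral_kernel_mul_fracInt hε hb hy.1 V).1) hM
  have h2 : ∫ y in (-1 : ℝ)..1, iteratedDeriv (k + 1) ω y *
        ∫ x in (-1 : ℝ)..y, (y - x) ^ (((k + 1 : ℕ) : ℝ) - α - 1) * fracInt (α - 1) V x =
      Real.Gamma (((k + 1 : ℕ) : ℝ) - α) *
        ∫ y in (-1 : ℝ)..1, iteratedDeriv (k + 1) ω y * fracInt k V y := by
    rw [← intervalIntegral.integral_const_mul]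
    refine intervalIntegral.integral_congr_Ioo_of_le (by norm_num) fun y hy => ?_
    simp only [(integral_kernel_mul_fracInt hε hb hy.1 V).2]
    have : α - 1 + (((k + 1 : ℕ) : ℝ) - α) = k := by push_cast; ring
    rw [this]
    ring
  simp only [caputoR, mul_assoc]
  rw [intervalIntegral.integral_const_mul, hswap, h2, pow_succ]
  field_simp

theorem abs_integral_caputoR_mul_fracInt_le {k m : ℕ} {α B : ℝ} {ω : ℝ → ℝ} {L : ℕ → ℝ}
    (hα : 0 < α) (hω : MemUR k m α ω L) {V : ℝ[X]}
    (hB1 : ∀ i < m, |fracInt (α + i) V 1| ≤ B) {n : ℕ} (hn : n ≤ m) :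
    |∫ x in (-1 : ℝ)..1, caputoR k α 1 ω x * fracInt (α - 1) V x| ≤
      B * ∑ i ∈ Finset.range n, |L i| +
        |∫ x in (-1 : ℝ)..1, iteratedDeriv n (caputoR k α 1 ω) x * fracInt (α + n - 1) V x| := by
  obtain ⟨-, -, -, hc, hci, hL⟩ := hω
  induction n with
  | zero => simp
  | succ n ih =>
    have hn0 := Nat.cast_nonneg (α := ℝ) n
    have h := integral_mul_deriv_eq_of_tendsto (hc n hn) (hci (n + 1) hn)
      (continuous_fracInt (β := α + n - 1 + 1) (by linarith) V).continuousOn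
      (fun x hx => hasDerivAt_fracInt (β := α + n - 1) (by linarith) V hx.1)
      (intervalIntegrable_fracInt (by linarith) (by norm_num) V)
      (fracInt_neg_one (by linarith) V) (hL n hn)
    refine (ih (by omega)).trans ?_
    rw [h, Finset.sum_range_succ, mul_add, add_assoc]
    refine add_le_add_right ((abs_sub _ _).trans ?_) _
    have e1 : α + ((n + 1 : ℕ) : ℝ) - 1 = α + n := by push_cast; ring
    rw [sub_add_cancel, e1, abs_mul, mul_comm]
    gcongr
    exact hB1 n hn

theorem abs_integral_deriv_mul_le {k m : ℕ} {α B : ℝ} {ω : ℝ → ℝ} {L : ℕ → ℝ}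
    (hα1 : (k : ℝ) < α) (hα2 : α < (k : ℝ) + 1)
    (hω : MemUR (k + 1) m α ω L) {V : ℝ[X]}
    (hV : ∀ q : ℝ[X], q.degree < k → ∫ x in (-1 : ℝ)..1, (q * V).eval x = 0)
    (hB1 : ∀ i < m, |fracInt (α + i) V 1| ≤ B)
    (hB : ∀ x ∈ Icc (-1 : ℝ) 1, |fracInt (α + m - 1) V x| ≤ B) :
    |∫ x in (-1 : ℝ)..1, iteratedDeriv 1 ω x * V.eval x| ≤ B * UsemiR (k + 1) m α ω L := by
  have hk := Nat.cast_nonneg (α := ℝ) k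
  rw [integral_deriv_mul_eq_caputoR hα1 hα2 hω hV, abs_neg]
  refine (abs_integral_caputoR_mul_fracInt_le (by linarith) hω hB1 le_rfl).trans ?_
  rw [UsemiR, mul_add, add_comm]
  refine add_le_add_left ?_ _
  have hci := hω.2.2.2.2.1 m le_rfl
  rw [← intervalIntegral.integral_const_mul]
  refine intervalIntegral.norm_integral_le_of_norm_le
    (f := fun x => iteratedDeriv m (caputoR (k + 1) α 1 ω) x * fracInt (α + m - 1) V x) (by norm_num)
    (Eventually.of_forall fun x hx => ?_) (hci.abs.const_mul B)
  rw [Real.norm_eq_abs, abs_mul, mul_comm]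
  exact mul_le_mul_of_nonneg_right (hB x (Ioc_subset_Icc_self hx)) (abs_nonneg _)

/-! ### Pairings of `ω'` with Legendre combinations -/

theorem mul_rpow_neg_le {C D x a b : ℝ} (hCD : C ≤ D) (hC : 0 ≤ C) (hx : 1 ≤ x) (hab : a ≤ b) :
    C * x ^ (-b) ≤ D * x ^ (-a) :=
  mul_le_mul hCD (Real.rpow_le_rpow_of_exponent_le hx (neg_le_neg hab)) (by positivity)
    (hC.trans hCD)

theorem exists_uniform_bound {f : ℕ → ℕ → ℝ} {b : ℕ → ℝ} {b₀ : ℝ} (hb : ∀ i, b₀ ≤ b i)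
    (h : ∀ i, ∃ C, 0 ≤ C ∧ ∀ n : ℕ, |f i n| ≤ C * ((n : ℝ) + 1) ^ (-b i)) (m : ℕ) :
    ∃ C, 0 ≤ C ∧ ∀ i < m, ∀ n : ℕ, |f i n| ≤ C * ((n : ℝ) + 1) ^ (-b₀) := by
  choose C hC0 hC using h
  refine ⟨∑ i ∈ Finset.range m, C i, Finset.sum_nonneg fun i _ => hC0 i, fun i hi n => ?_⟩
  exact (hC i n).trans (mul_rpow_neg_le
    (Finset.single_le_sum (fun i _ => hC0 i) (Finset.mem_range.2 hi)) (hC0 i) (by simp) (hb i))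

theorem exists_abs_integral_deriv_mul_le {k m : ℕ} {α b₀ : ℝ} {b : ℕ → ℝ}
    (hα1 : (k : ℝ) < α) (hα2 : α < (k : ℝ) + 1) {V : ℕ → ℝ[X]}
    (hV : ∀ n ≥ k, ∀ q : ℝ[X], q.degree < n → ∫ x in (-1 : ℝ)..1, (q * V n).eval x = 0)
    (hb : ∀ i, b₀ ≤ b i)
    (h1 : ∀ i : ℕ, ∃ C, 0 ≤ C ∧ ∀ n : ℕ,
      |fracInt (α + i) (V n) 1| ≤ C * ((n : ℝ) + 1) ^ (-b i))
    (h2 : ∃ C, 0 ≤ C ∧ ∀ n : ℕ, ∀ x ∈ Icc (-1 : ℝ) 1,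
      |fracInt (α + m - 1) (V n) x| ≤ C * ((n : ℝ) + 1) ^ (-b₀)) :
    ∃ C, 0 ≤ C ∧ ∀ n ≥ k, ∀ (ω : ℝ → ℝ) (L : ℕ → ℝ), MemUR (k + 1) m α ω L →
      |∫ x in (-1 : ℝ)..1, iteratedDeriv 1 ω x * (V n).eval x| ≤
        C * ((n : ℝ) + 1) ^ (-b₀) * UsemiR (k + 1) m α ω L := by
  obtain ⟨C₁, hC₁0, hC₁⟩ := exists_uniform_bound hb h1 m
  obtain ⟨C₂, hC₂0, hC₂⟩ := h2
  refine ⟨max C₁ C₂, le_max_of_le_left hC₁0, fun n hn ω L hω => ?_⟩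
  refine abs_integral_deriv_mul_le hα1 hα2 hω
    (fun q hq => hV n hn q (hq.trans_le (by exact_mod_cast hn))) (fun i hi => ?_) fun x hx => ?_
  · refine (hC₁ i hi n).trans ?_
    gcongr
    exact le_max_left _ _
  · refine (hC₂ n x hx).trans ?_
    gcongr
    exact le_max_right _ _

theorem integral_mul_legendreP_add_eq_zero {n : ℕ} {q : ℝ[X]} (hq : q.degree < n) (c d : ℝ)
    (N : ℕ) (hN : n ≤ N) :
    ∫ x in (-1 : ℝ)..1, (q * (C c * legendreP N + C d * legendreP n)).eval x = 0 := by
  have h1 := integral_mul_legendreP_eq_zero (hq.trans_le (by exact_mod_cast hN : (n : WithBot ℕ) ≤ N))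
  have h2 := integral_mul_legendreP_eq_zero hq
  have : ∀ x, (q * (C c * legendreP N + C d * legendreP n)).eval x =
      c * (q * legendreP N).eval x + d * (q * legendreP n).eval x := fun x => by
    simp only [eval_mul, eval_add, eval_C]; ring
  simp only [this]
  rw [intervalIntegral.integral_add ((intervalIntegrable_eval _ _ _).const_mul c)
    ((intervalIntegrable_eval _ _ _).const_mul d), intervalIntegral.integral_const_mul,
    intervalIntegral.integral_const_mul, h1, h2]
  simp

theorem exists_abs_integral_deriv_mul_legendreAnti_le {k m : ℕ} {α : ℝ}
    (hα1 : (k : ℝ) < α) (hα2 : α < (k : ℝ) + 1) (hm : 1 ≤ m) :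
    ∃ C, 0 ≤ C ∧ ∀ n ≥ k, ∀ (ω : ℝ → ℝ) (L : ℕ → ℝ), MemUR (k + 1) m α ω L →
      |∫ x in (-1 : ℝ)..1, iteratedDeriv 1 ω x * (legendreAnti n).eval x| ≤
        C * ((n : ℝ) + 1) ^ (-min (2 * α + 2) (α + m + 1 / 2)) *
          UsemiR (k + 1) m α ω L := by
  have hk := Nat.cast_nonneg (α := ℝ) k
  have hm' : (1 : ℝ) ≤ m := by exact_mod_cast hm
  have hshift : ∀ (n : ℕ) (c : ℝ), 0 ≤ c →
      (((n + 1 : ℕ) : ℝ) + 1) ^ (-c) ≤ ((n : ℝ) + 1) ^ (-c) := fun n c hc =>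
    Real.rpow_le_rpow_of_nonpos (by positivity) (by push_cast; linarith) (by linarith)
  refine exists_abs_integral_deriv_mul_le (b := fun i => 2 * (α + i + 1)) hα1 hα2
    (fun n _ q hq => ?_) (fun i => ?_) (fun i => ?_) ?_
  · have := integral_mul_legendreP_add_eq_zero hq ((2 * (n : ℝ) + 3)⁻¹) (-(2 * (n : ℝ) + 3)⁻¹)
      (n + 2) (by omega)
    rw [C_neg, neg_mul, ← sub_eq_add_neg, ← mul_sub] at this
    exact this
  · have := Nat.cast_nonneg (α := ℝ) i
    exact (min_le_left _ _).trans (by linarith)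
  · have hi := Nat.cast_nonneg (α := ℝ) i
    obtain ⟨C, hC0, hC⟩ := exists_abs_fracInt_legendreP_one_le (β := α + i + 1) (by linarith)
    refine ⟨C, hC0, fun n => ?_⟩
    rw [← fracInt_legendreP_succ]
    exact (hC (n + 1)).trans (mul_le_mul_of_nonneg_left (hshift n _ (by linarith)) hC0)
  · obtain ⟨C, hC0, hC⟩ := legendreDecay_add_half (β := α + m) (by linarith)
    refine ⟨C, hC0, fun n x hx => ?_⟩
    rw [← fracInt_legendreP_succ, sub_add_cancel]
    refine (hC (n + 1) x hx).trans ((mul_le_mul_of_nonneg_left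
      (hshift n _ (by linarith)) hC0).trans ?_)
    exact mul_rpow_neg_le le_rfl hC0 (by simp) (min_le_right _ _)

theorem fracInt_legendreP_combination (β c d : ℝ) (n : ℕ) (x : ℝ) :
    fracInt β (C c * legendreP (n + 1) + C d * legendreP n) x =
      c * fracInt β (legendreP (n + 1)) x + d * fracInt β (legendreP n) x := by
  rw [fracInt_add, fracInt_C_mul, fracInt_C_mul]

theorem abs_half_combination_le {σ u v B : ℝ} (hσ : |σ| ≤ 1) (hu : |u| ≤ B) (hv : |v| ≤ B) :
    |1 / 2 * u + σ / 2 * v| ≤ B := by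
  have h : |σ * v| ≤ B := by
    rw [abs_mul]
    exact (mul_le_of_le_one_left (abs_nonneg _) hσ).trans hv
  rw [abs_le] at *
  constructor <;> linarith

theorem exists_abs_fracInt_half_combination_le {σ β : ℝ} (hσ : |σ| ≤ 1) (hβ : 0 ≤ β) {b : ℝ}
    (hb : b ≤ β) :
    ∃ K, 0 ≤ K ∧ ∀ n : ℕ, ∀ x ∈ Icc (-1 : ℝ) 1,
      |fracInt β (C (1 / 2) * legendreP (n + 1) + C (σ / 2) * legendreP n) x| ≤
        K * ((n : ℝ) + 1) ^ (-b) := by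
  obtain ⟨K, hK0, hK⟩ := legendreDecay_self hβ
  refine ⟨K, hK0, fun n x hx => ?_⟩
  refine le_trans ?_ (mul_rpow_neg_le le_rfl hK0 (by simp) hb)
  rw [fracInt_legendreP_combination]
  refine abs_half_combination_le hσ ((hK (n + 1) x hx).trans ?_) (hK n x hx)
  exact mul_le_mul_of_nonneg_left
    (Real.rpow_le_rpow_of_nonpos (by positivity) (by push_cast; linarith) (by linarith)) hK0

theorem exists_abs_integral_deriv_mul_sum_le {k m : ℕ} {α : ℝ}
    (hα1 : (k : ℝ) < α) (hα2 : α < (k : ℝ) + 1) (hm : 1 ≤ m) :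
    ∃ K, 0 ≤ K ∧ ∀ n ≥ k, ∀ (ω : ℝ → ℝ) (L : ℕ → ℝ), MemUR (k + 1) m α ω L →
      |∫ x in (-1 : ℝ)..1, iteratedDeriv 1 ω x *
          (C (1 / 2) * legendreP (n + 1) + C (1 / 2) * legendreP n).eval x| ≤
        K * ((n : ℝ) + 1) ^ (-min (2 * α) (α + m - 1)) * UsemiR (k + 1) m α ω L := by
  have hk := Nat.cast_nonneg (α := ℝ) k
  have hm' : (1 : ℝ) ≤ m := by exact_mod_cast hm
  refine exists_abs_integral_deriv_mul_le (b := fun i => 2 * (α + i)) hα1 hα2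
    (fun n _ q hq => integral_mul_legendreP_add_eq_zero hq _ _ _ (by omega)) (fun i => ?_)
    (fun i => ?_) (exists_abs_fracInt_half_combination_le (by simp) (by linarith)
      (min_le_right _ _))
  · have := Nat.cast_nonneg (α := ℝ) i
    exact (min_le_left _ _).trans (by linarith)
  · have hi := Nat.cast_nonneg (α := ℝ) i
    obtain ⟨K, hK0, hK⟩ := exists_abs_fracInt_legendreP_one_le (β := α + i) (by linarith)
    refine ⟨K, hK0, fun n => ?_⟩
    rw [fracInt_legendreP_combination]
    refine abs_half_combination_le (by simp) ((hK (n + 1)).trans ?_) (hK n)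
    exact mul_le_mul_of_nonneg_left (Real.rpow_le_rpow_of_nonpos (by positivity)
      (by push_cast; linarith) (by linarith)) hK0

theorem exists_abs_integral_deriv_mul_diff_le {k m : ℕ} {α : ℝ}
    (hα1 : (k : ℝ) < α) (hα2 : α < (k : ℝ) + 1) (hm : 1 ≤ m) :
    ∃ K, 0 ≤ K ∧ ∀ n ≥ k, ∀ (ω : ℝ → ℝ) (L : ℕ → ℝ), MemUR (k + 1) m α ω L →
      |∫ x in (-1 : ℝ)..1, iteratedDeriv 1 ω x *
          (C (1 / 2) * legendreP (n + 1) + C (-1 / 2) * legendreP n).eval x| ≤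
        K * ((n : ℝ) + 1) ^ (-min (2 * α + 1) (α + m - 1)) * UsemiR (k + 1) m α ω L := by
  have hk := Nat.cast_nonneg (α := ℝ) k
  have hm' : (1 : ℝ) ≤ m := by exact_mod_cast hm
  refine exists_abs_integral_deriv_mul_le (b := fun i => 2 * (α + i) + 1) hα1 hα2
    (fun n _ q hq => integral_mul_legendreP_add_eq_zero hq _ _ _ (by omega)) (fun i => ?_)
    (fun i => ?_) (exists_abs_fracInt_half_combination_le (by simp) (by linarith)
      (min_le_right _ _))
  · have := Nat.cast_nonneg (α := ℝ) i
    exact (min_le_left _ _).trans (by linarith)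
  · have hi := Nat.cast_nonneg (α := ℝ) i
    obtain ⟨K, hK0, hK⟩ := exists_abs_fracInt_legendreP_one_sub_le (β := α + i) (by linarith)
    refine ⟨K, hK0, fun n => ?_⟩
    rw [fracInt_legendreP_combination]
    have h := hK n
    rw [abs_le] at h ⊢
    have : 0 ≤ K * ((n : ℝ) + 1) ^ (-(2 * (α + i) + 1)) := by positivity
    constructor <;> linarith

/-! ### The `L²` error -/

theorem intervalIntegrable_of_continuousOn_Icc {g : ℝ → ℝ} (hg : ContinuousOn g (Icc (-1) 1)) :
    IntervalIntegrable g volume (-1) 1 :=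
  ContinuousOn.intervalIntegrable (by rwa [uIcc_of_le (by norm_num)])

theorem integral_sq_le_of_legendre_coeff {g : ℝ → ℝ} {T : ℝ} (hg : ContinuousOn g (Icc (-1) 1))
    (hT : ∀ M : ℕ, ∑ j ∈ Finset.range M, (2 * (j : ℝ) + 1) / 2 *
      (∫ x in (-1 : ℝ)..1, g x * (legendreP j).eval x) ^ 2 ≤ T) :
    ∫ x in (-1 : ℝ)..1, g x ^ 2 ≤ T := by
  have hle : (-1 : ℝ) ≤ 1 := by norm_num
  have main : ∀ ε > 0, ∫ x in (-1 : ℝ)..1, g x ^ 2 ≤ T + 2 * ε ^ 2 := by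
    intro ε hε
    obtain ⟨R, hR⟩ := exists_polynomial_near_of_continuousOn (-1) 1 g hg ε hε
    obtain ⟨b, hb⟩ := exists_sum_legendreP (q := R) (n := R.natDegree + 1)
      (by exact_mod_cast lt_of_le_of_lt degree_le_natDegree (by exact_mod_cast Nat.lt_succ_self _))
    set M := R.natDegree + 1
    have hpi : ∀ q : ℝ[X], IntervalIntegrable (fun x => g x * q.eval x) volume (-1) 1 := fun q =>
      intervalIntegrable_of_continuousOn_Icc (hg.mul q.continuous.continuousOn)
    have hsq : IntervalIntegrable (fun x => g x ^ 2) volume (-1) 1 :=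
      intervalIntegrable_of_continuousOn_Icc (hg.pow 2)
    have hdiff : IntervalIntegrable (fun x => (g x - R.eval x) ^ 2) volume (-1) 1 :=
      intervalIntegrable_of_continuousOn_Icc ((hg.sub R.continuous.continuousOn).pow 2)
    have hgR : ∫ x in (-1 : ℝ)..1, g x * R.eval x = ∑ j ∈ Finset.range M,
        b j * ∫ x in (-1 : ℝ)..1, g x * (legendreP j).eval x := by
      simp only [← intervalIntegral.integral_const_mul]
      rw [← intervalIntegral.integral_finsetSum fun j _ => (hpi _).const_mul _]
      refine intervalIntegral.integral_congr fun x _ => ?_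
      nth_rewrite 1 [hb]
      rw [eval_finsetSum, Finset.mul_sum]
      exact Finset.sum_congr rfl fun j _ => by simp only [eval_mul, eval_C]; ring
    have hRj : ∀ j ∈ Finset.range M, ∫ x in (-1 : ℝ)..1, (R * legendreP j).eval x =
        b j * (2 / (2 * (j : ℝ) + 1)) := by
      intro j hj
      have : ∀ x, (R * legendreP j).eval x =
          ∑ i ∈ Finset.range M, b i * (legendreP i * legendreP j).eval x := fun x => by
        nth_rewrite 1 [hb]
        rw [eval_mul, eval_finsetSum, Finset.sum_mul]
        exact Finset.sum_congr rfl fun i _ => by simp only [eval_mul, eval_C]; ring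
      simp only [this]
      rw [intervalIntegral.integral_finsetSum
        fun i _ => (intervalIntegrable_eval _ _ _).const_mul _]
      simp only [intervalIntegral.integral_const_mul]
      rw [Finset.sum_eq_single_of_mem j hj fun i _ hij => by
        rw [integral_legendreP_mul_legendreP hij, mul_zero], integral_legendreP_sq]
    have hRR : ∫ x in (-1 : ℝ)..1, R.eval x ^ 2 = ∑ j ∈ Finset.range M,
        b j * (b j * (2 / (2 * (j : ℝ) + 1))) := by
      have : ∀ x, R.eval x ^ 2 = ∑ j ∈ Finset.range M, b j * (R * legendreP j).eval x :=
        fun x => by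
          rw [sq]
          nth_rewrite 2 [hb]
          rw [eval_finsetSum, Finset.mul_sum]
          exact Finset.sum_congr rfl fun i _ => by simp only [eval_mul, eval_C]; ring
      simp only [this]
      rw [intervalIntegral.integral_finsetSum
        fun i _ => (intervalIntegrable_eval _ _ _).const_mul _]
      simp only [intervalIntegral.integral_const_mul]
      exact Finset.sum_congr rfl fun j hj => by rw [hRj j hj]
    have hexp : ∫ x in (-1 : ℝ)..1, g x ^ 2 = (∫ x in (-1 : ℝ)..1, (g x - R.eval x) ^ 2) +
        2 * (∫ x in (-1 : ℝ)..1, g x * R.eval x) - ∫ x in (-1 : ℝ)..1, R.eval x ^ 2 := by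
      have hRi : IntervalIntegrable (fun x => R.eval x ^ 2) volume (-1) 1 :=
        (R.continuous.pow 2).intervalIntegrable _ _
      rw [← intervalIntegral.integral_const_mul,
        ← intervalIntegral.integral_add hdiff ((hpi R).const_mul 2),
        ← intervalIntegral.integral_sub (hdiff.add ((hpi R).const_mul 2)) hRi]
      refine intervalIntegral.integral_congr fun x _ => ?_
      ring
    have hsmall : ∫ x in (-1 : ℝ)..1, (g x - R.eval x) ^ 2 ≤ 2 * ε ^ 2 := by
      have : ∫ x in (-1 : ℝ)..1, (g x - R.eval x) ^ 2 ≤ ∫ _ in (-1 : ℝ)..1, ε ^ 2 := by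
        refine intervalIntegral.integral_mono_on hle hdiff (by simp) fun x hx => ?_
        rw [← sq_abs, abs_sub_comm]
        exact pow_le_pow_left₀ (abs_nonneg _) (hR x hx).le 2
      refine this.trans_eq ?_
      rw [intervalIntegral.integral_const, smul_eq_mul]
      norm_num
    have hterm : 2 * (∫ x in (-1 : ℝ)..1, g x * R.eval x) - ∫ x in (-1 : ℝ)..1, R.eval x ^ 2 ≤
        ∑ j ∈ Finset.range M, (2 * (j : ℝ) + 1) / 2 *
          (∫ x in (-1 : ℝ)..1, g x * (legendreP j).eval x) ^ 2 := by
      rw [hgR, hRR, Finset.mul_sum, ← Finset.sum_sub_distrib]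
      refine Finset.sum_le_sum fun j _ => ?_
      generalize ∫ x in (-1 : ℝ)..1, g x * (legendreP j).eval x = e
      have hj : (0 : ℝ) < 2 * (j : ℝ) + 1 := by positivity
      have h : 0 ≤ 2 / (2 * (j : ℝ) + 1) * (b j - (2 * (j : ℝ) + 1) / 2 * e) ^ 2 := by positivity
      have h2 : 2 / (2 * (j : ℝ) + 1) * (b j - (2 * (j : ℝ) + 1) / 2 * e) ^ 2 =
          (2 * (j : ℝ) + 1) / 2 * e ^ 2 -
            (2 * (b j * e) - b j * (b j * (2 / (2 * (j : ℝ) + 1)))) := by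
        field_simp
        ring
      linarith
    have := hT M
    linarith
  by_contra! hlt
  have h := main (Real.sqrt (((∫ x in (-1 : ℝ)..1, g x ^ 2) - T) / 4))
    (Real.sqrt_pos.2 (by linarith))
  rw [Real.sq_sqrt (by linarith)] at h
  linarith

theorem exists_sum_Ico_rpow_le {q : ℝ} (hq : 0 < q) :
    ∃ S, 0 ≤ S ∧ ∀ n M : ℕ,
      ∑ i ∈ Finset.Ico n M, ((i : ℝ) + 1) ^ (-q - 1) ≤ S * ((n : ℝ) + 1) ^ (-q) := by
  have step : ∀ x : ℝ, 1 ≤ x → x ^ (-q - 1) ≤ (2 + q) / q * (x ^ (-q) - (x + 1) ^ (-q)) := by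
    intro x hx
    have hx0 : 0 < x := by linarith
    have hr : (x + 1) ^ (-q) = x ^ (-q) * (x / (x + 1)) ^ q := by
      rw [Real.div_rpow hx0.le (by linarith), Real.rpow_neg hx0.le, Real.rpow_neg (by linarith)]
      field_simp
    have hlog : Real.log (x / (x + 1)) ≤ -(1 / (2 * x)) := by
      have h1 := Real.log_le_sub_one_of_pos (x := x / (x + 1)) (by positivity)
      have h2 : x / (x + 1) - 1 = -(1 / (x + 1)) := by field_simp; ring
      have h3 : 1 / (2 * x) ≤ 1 / (x + 1) := by gcongr; linarith
      linarith
    have hexp : (x / (x + 1)) ^ q ≤ 1 - q / (2 + q) * x⁻¹ := by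
      rw [Real.rpow_def_of_pos (by positivity)]
      have h1 : Real.log (x / (x + 1)) * q ≤ -(q / (2 * x)) := by
        have := mul_le_mul_of_nonneg_right hlog hq.le
        refine this.trans_eq ?_
        ring
      refine (Real.exp_le_exp.2 h1).trans ?_
      rw [Real.exp_neg]
      have h2 : 1 + q / (2 * x) ≤ Real.exp (q / (2 * x)) := by
        rw [add_comm]; exact Real.add_one_le_exp _
      refine (inv_anti₀ (by positivity) h2).trans ?_
      rw [inv_le_iff_one_le_mul₀ (by positivity)]
      have h4 : (1 - q / (2 + q) * x⁻¹) * (1 + q / (2 * x)) - 1 =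
          q ^ 2 * (x - 1) / (2 * (2 + q) * x ^ 2) := by
        field_simp
        ring
      have h5 : 0 ≤ q ^ 2 * (x - 1) / (2 * (2 + q) * x ^ 2) :=
        div_nonneg (mul_nonneg (sq_nonneg q) (by linarith)) (by positivity)
      linarith
    have h6 : x ^ (-q - 1) = x ^ (-q) * x⁻¹ := by
      rw [sub_eq_add_neg, Real.rpow_add hx0, Real.rpow_neg_one]
    have h7 : (2 + q) / q * (q / (2 + q) * x⁻¹) = x⁻¹ := by field_simp
    rw [hr, h6]
    calc x ^ (-q) * x⁻¹ = x ^ (-q) * ((2 + q) / q * (q / (2 + q) * x⁻¹)) := by rw [h7]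
      _ ≤ x ^ (-q) * ((2 + q) / q * (1 - (x / (x + 1)) ^ q)) := by
          gcongr
          linarith
      _ = _ := by ring
  refine ⟨(2 + q) / q, by positivity, fun n M => ?_⟩
  rcases le_total M n with hMn | hMn
  · rw [Finset.Ico_eq_empty_of_le hMn, Finset.sum_empty]
    positivity
  suffices ∑ i ∈ Finset.Ico n M, ((i : ℝ) + 1) ^ (-q - 1) ≤
      (2 + q) / q * (((n : ℝ) + 1) ^ (-q) - ((M : ℝ) + 1) ^ (-q)) by
    refine this.trans ?_
    gcongr
    have : 0 ≤ ((M : ℝ) + 1) ^ (-q) := by positivity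
    linarith
  induction M, hMn using Nat.le_induction with
  | base => simp
  | succ M hM ih =>
    rw [Finset.sum_Ico_succ_top hM]
    have := step ((M : ℝ) + 1) (by simp)
    push_cast
    linarith

theorem integral_derivative_mul_legendreP_combination {n : ℕ} {P : ℝ[X]}
    (hP : P.natDegree ≤ n + 1) (σ : ℝ) :
    ∫ x in (-1 : ℝ)..1, (derivative P *
      (C (1 / 2) * legendreP (n + 1) + C (σ / 2) * legendreP n)).eval x =
      σ * ((2 * (n : ℝ) + 3) / 2 * ∫ x in (-1 : ℝ)..1, (P * legendreP (n + 1)).eval x) := by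
  obtain ⟨d, hd⟩ := exists_sub_legendreP_degree_lt (n := n + 1) (q := P)
    (lt_of_le_of_lt degree_le_natDegree (by exact_mod_cast Nat.lt_succ_of_le hP))
  have hdeg : ∀ q : ℝ[X], ∀ N : ℕ, q.degree < (N + 1 : ℕ) → (derivative q).degree < N := by
    intro q N hq
    rw [degree_lt_iff_coeff_zero] at hq ⊢
    intro j hj
    rw [coeff_derivative, hq (j + 1) (by omega), zero_mul]
  have hnat : ∀ N, (legendreP N).degree < (N + 1 : ℕ) := fun N =>
    lt_of_le_of_lt degree_le_natDegree
      (by exact_mod_cast Nat.lt_succ_of_le (legendreP_natDegree_le N))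
  set Q := P - C d * legendreP (n + 1) with hQ
  have hPQ : P = C d * legendreP (n + 1) + Q := by rw [hQ]; ring
  have h1 : ∫ x in (-1 : ℝ)..1, (P * legendreP (n + 1)).eval x = d * (2 / (2 * (n : ℝ) + 3)) := by
    have e : ∀ x, (P * legendreP (n + 1)).eval x =
        d * (legendreP (n + 1) * legendreP (n + 1)).eval x + (Q * legendreP (n + 1)).eval x :=
      fun x => by rw [hPQ]; simp only [eval_mul, eval_add, eval_C]; ring
    simp only [e]
    rw [intervalIntegral.integral_add ((intervalIntegrable_eval _ _ _).const_mul _)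
      (intervalIntegrable_eval _ _ _), intervalIntegral.integral_const_mul,
      integral_legendreP_sq, integral_mul_legendreP_eq_zero hd]
    push_cast
    ring
  have h2 : ∫ x in (-1 : ℝ)..1, (derivative (legendreP (n + 1)) * legendreP n).eval x = 2 := by
    have hparts := integral_derivative_eval (legendreP (n + 1) * legendreP n) (-1) 1
    have e : ∀ x, (derivative (legendreP (n + 1) * legendreP n)).eval x =
        (derivative (legendreP (n + 1)) * legendreP n).eval x +
          (derivative (legendreP n) * legendreP (n + 1)).eval x := fun x => by
      rw [derivative_mul]; simp only [eval_mul, eval_add]; ring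
    simp only [e] at hparts
    rw [intervalIntegral.integral_add (intervalIntegrable_eval _ _ _)
      (intervalIntegrable_eval _ _ _), integral_mul_legendreP_eq_zero
        ((hdeg _ _ (hnat n)).trans (by exact_mod_cast Nat.lt_succ_self n)), add_zero, eval_mul,
      eval_mul, legendreP_eval_one, legendreP_eval_one, legendreP_eval_neg_one,
      legendreP_eval_neg_one, ← pow_add] at hparts
    rw [hparts, show n + 1 + n = 2 * n + 1 by ring, pow_succ, pow_mul]
    norm_num
  have h3 : ∫ x in (-1 : ℝ)..1, (derivative P * legendreP n).eval x = 2 * d := by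
    have e : ∀ x, (derivative P * legendreP n).eval x =
        d * (derivative (legendreP (n + 1)) * legendreP n).eval x +
          (derivative Q * legendreP n).eval x := fun x => by
      rw [hPQ, derivative_add, derivative_C_mul]; simp only [eval_mul, eval_add, eval_C]; ring
    simp only [e]
    rw [intervalIntegral.integral_add ((intervalIntegrable_eval _ _ _).const_mul _)
      (intervalIntegrable_eval _ _ _), intervalIntegral.integral_const_mul, h2,
      integral_mul_legendreP_eq_zero (hdeg _ _ hd)]
    ring
  have h4 : ∫ x in (-1 : ℝ)..1, (derivative P * legendreP (n + 1)).eval x = 0 :=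
    integral_mul_legendreP_eq_zero (hdeg _ _ (lt_of_le_of_lt degree_le_natDegree
      (by exact_mod_cast Nat.lt_succ_of_le hP)))
  have e : ∀ x, (derivative P *
      (C (1 / 2) * legendreP (n + 1) + C (σ / 2) * legendreP n)).eval x =
      1 / 2 * (derivative P * legendreP (n + 1)).eval x +
        σ / 2 * (derivative P * legendreP n).eval x := fun x => by
    simp only [eval_mul, eval_add, eval_C]; ring
  simp only [e]
  rw [intervalIntegral.integral_add ((intervalIntegrable_eval _ _ _).const_mul _)
    ((intervalIntegrable_eval _ _ _).const_mul _), intervalIntegral.integral_const_mul,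
    intervalIntegral.integral_const_mul, h3, h4, h1]
  field_simp
  ring

theorem MemUR.integral_deriv_mul {k m : ℕ} {α : ℝ} {ω : ℝ → ℝ} {L : ℕ → ℝ}
    (hω : MemUR (k + 1) m α ω L) (W : ℝ[X]) :
    ∫ x in (-1 : ℝ)..1, iteratedDeriv 1 ω x * W.eval x =
      ω 1 * W.eval 1 - ω (-1) * W.eval (-1) -
        ∫ x in (-1 : ℝ)..1, ω x * (derivative W).eval x := by
  have hle : (-1 : ℝ) ≤ 1 := by norm_num
  have h := intervalIntegral.integral_mul_deriv_eq_deriv_mul_of_hasDerivAt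
    (a := -1) (b := 1) (u := ω) (v := fun x => W.eval x) (u' := iteratedDeriv 1 ω)
    (v' := fun x => (derivative W).eval x)
    (by rw [uIcc_of_le hle]; exact hω.1) W.continuous.continuousOn
    (fun x hx => by
      rw [min_eq_left hle, max_eq_right hle] at hx
      have := hω.2.1 0 (by omega) x hx
      rwa [iteratedDeriv_zero] at this)
    (fun x _ => W.hasDerivAt x) (hω.2.2.1 1 (by omega)) (intervalIntegrable_eval _ _ _)
  linarith

theorem MemUR.integral_mul_legendreP_succ {k m : ℕ} {α : ℝ} {ω : ℝ → ℝ} {L : ℕ → ℝ}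
    (hω : MemUR (k + 1) m α ω L) (n : ℕ) :
    ∫ x in (-1 : ℝ)..1, ω x * (legendreP (n + 1)).eval x =
      -∫ x in (-1 : ℝ)..1, iteratedDeriv 1 ω x * (legendreAnti n).eval x := by
  rw [hω.integral_deriv_mul, legendreAnti_eval_one, legendreAnti_eval_neg_one,
    derivative_legendreAnti]
  ring

theorem MemUR.abs_integral_radau_mul_legendreP {k m n : ℕ} {α σ : ℝ} {ω : ℝ → ℝ} {L : ℕ → ℝ}
    (hω : MemUR (k + 1) m α ω L) {P : ℝ[X]} (hP : P.natDegree ≤ n + 1)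
    (horth : ∀ v : ℝ[X], v.natDegree < n + 1 →
      ∫ x in (-1 : ℝ)..1, (P.eval x - ω x) * v.eval x = 0)
    (hσ : σ = 1 ∧ P.eval 1 = ω 1 ∨ σ = -1 ∧ P.eval (-1) = ω (-1)) :
    |∫ x in (-1 : ℝ)..1, (P * legendreP (n + 1)).eval x| = 2 / (2 * (n : ℝ) + 3) *
      |∫ x in (-1 : ℝ)..1, iteratedDeriv 1 ω x *
        (C (1 / 2) * legendreP (n + 1) + C (σ / 2) * legendreP n).eval x| := by
  set W := C (1 / 2) * legendreP (n + 1) + C (σ / 2) * legendreP n with hW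
  have hWdeg : W.natDegree ≤ n + 1 := by
    refine natDegree_add_le_of_degree_le ?_ ?_
    · exact (natDegree_C_mul_le _ _).trans (legendreP_natDegree_le _)
    · exact (natDegree_C_mul_le _ _).trans ((legendreP_natDegree_le _).trans (by omega))
  have hW' := horth (derivative W)
    (lt_of_le_of_lt (natDegree_derivative_le W) (by omega))
  have hωi : IntervalIntegrable (fun x => ω x * (derivative W).eval x) volume (-1) 1 :=
    intervalIntegrable_of_continuousOn_Icc (hω.1.mul (derivative W).continuous.continuousOn)
  have hPi := intervalIntegrable_eval (P * derivative W) (-1) 1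
  have hPω : ∫ x in (-1 : ℝ)..1, (P * derivative W).eval x =
      ∫ x in (-1 : ℝ)..1, ω x * (derivative W).eval x := by
    rw [← sub_eq_zero, ← intervalIntegral.integral_sub hPi hωi, ← hW']
    exact intervalIntegral.integral_congr fun x _ => by simp only [eval_mul]; ring
  have hPparts : ∫ x in (-1 : ℝ)..1, (derivative P * W).eval x =
      P.eval 1 * W.eval 1 - P.eval (-1) * W.eval (-1) -
        ∫ x in (-1 : ℝ)..1, (P * derivative W).eval x := by
    have h := integral_derivative_eval (P * W) (-1) 1
    simp only [derivative_mul, eval_add] at h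
    rw [intervalIntegral.integral_add (intervalIntegrable_eval _ _ _) hPi, eval_mul,
      eval_mul] at h
    linarith
  have hbdry : P.eval 1 * W.eval 1 - P.eval (-1) * W.eval (-1) =
      ω 1 * W.eval 1 - ω (-1) * W.eval (-1) := by
    have h1 : W.eval 1 = 1 / 2 + σ / 2 := by
      simp [hW, legendreP_eval_one]
    have h2 : W.eval (-1) = (-1) ^ n * (σ / 2 - 1 / 2) := by
      simp only [hW, eval_add, eval_mul, eval_C, legendreP_eval_neg_one, pow_succ]
      ring
    rcases hσ with ⟨rfl, h⟩ | ⟨rfl, h⟩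
    · rw [h1, h2, h]; ring
    · rw [h1, h2, h]; ring
  have hpos : 0 < (2 * (n : ℝ) + 3) / 2 := by positivity
  have habs : |σ| = 1 := by rcases hσ with ⟨rfl, -⟩ | ⟨rfl, -⟩ <;> simp
  rw [hω.integral_deriv_mul W, ← hbdry, ← hPω, ← hPparts, hW,
    integral_derivative_mul_legendreP_combination hP, abs_mul, habs, one_mul, abs_mul,
    abs_of_pos hpos, ← mul_assoc]
  field_simp

theorem MemUR.integral_sq_sub_le {k m n : ℕ} {α a q K D S : ℝ} {ω : ℝ → ℝ} {L : ℕ → ℝ}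
    (hω : MemUR (k + 1) m α ω L) {P : ℝ[X]}
    (horth : ∀ v : ℝ[X], v.natDegree < n + 1 →
      ∫ x in (-1 : ℝ)..1, (P.eval x - ω x) * v.eval x = 0)
    (hPdeg : P.natDegree ≤ n + 1)
    (hK : ∀ j ≥ n, |∫ x in (-1 : ℝ)..1, iteratedDeriv 1 ω x * (legendreAnti j).eval x| ≤
      K * ((j : ℝ) + 1) ^ (-a))
    (hD : |∫ x in (-1 : ℝ)..1, (P * legendreP (n + 1)).eval x| ≤ 2 / (2 * (n : ℝ) + 3) * D)
    (hq : 2 * a = q + 2)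
    (hS : ∀ n M : ℕ,
      ∑ i ∈ Finset.Ico n M, ((i : ℝ) + 1) ^ (-q - 1) ≤ S * ((n : ℝ) + 1) ^ (-q)) :
    ∫ x in (-1 : ℝ)..1, (ω x - P.eval x) ^ 2 ≤
      3 * K ^ 2 * (S * ((n : ℝ) + 1) ^ (-q)) + 2 * D ^ 2 * ((n : ℝ) + 1)⁻¹ := by
  have hg : ContinuousOn (fun x => ω x - P.eval x) (Icc (-1) 1) :=
    hω.1.sub P.continuous.continuousOn
  set f := ∫ x in (-1 : ℝ)..1, (P * legendreP (n + 1)).eval x with hf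
  set c : ℕ → ℝ := fun j => ∫ x in (-1 : ℝ)..1, ω x * (legendreP (j + 1)).eval x with hc
  have hωi : ∀ j, IntervalIntegrable (fun x => ω x * (legendreP j).eval x) volume (-1) 1 :=
    fun j => intervalIntegrable_of_continuousOn_Icc (hω.1.mul (legendreP j).continuous.continuousOn)
  have hlow : ∀ j < n + 1, ∫ x in (-1 : ℝ)..1, (ω x - P.eval x) * (legendreP j).eval x = 0 := by
    intro j hj
    rw [← neg_eq_zero, ← intervalIntegral.integral_neg,
      ← horth (legendreP j) ((legendreP_natDegree_le j).trans_lt hj)]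
    exact intervalIntegral.integral_congr fun x _ => by ring
  have hhigh : ∀ j ≥ n, ∫ x in (-1 : ℝ)..1, (ω x - P.eval x) * (legendreP (j + 1)).eval x =
      c j - if j = n then f else 0 := by
    intro j hj
    have e : ∫ x in (-1 : ℝ)..1, (ω x - P.eval x) * (legendreP (j + 1)).eval x =
        c j - ∫ x in (-1 : ℝ)..1, (P * legendreP (j + 1)).eval x := by
      rw [hc, ← intervalIntegral.integral_sub (hωi _) (intervalIntegrable_eval _ _ _)]
      exact intervalIntegral.integral_congr fun x _ => by simp only [eval_mul]; ring
    rw [e]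
    split_ifs with h
    · rw [h]
    · rw [integral_mul_legendreP_eq_zero (lt_of_le_of_lt degree_le_natDegree
        (by exact_mod_cast (by omega : P.natDegree < j + 1)))]
  have hcb : ∀ j ≥ n, c j ^ 2 ≤ K ^ 2 * ((j : ℝ) + 1) ^ (-q - 2) := by
    intro j hj
    have h1 : |c j| ≤ K * ((j : ℝ) + 1) ^ (-a) := by
      change |∫ x in (-1 : ℝ)..1, ω x * (legendreP (j + 1)).eval x| ≤ _
      rw [hω.integral_mul_legendreP_succ, abs_neg]
      exact hK j hj
    have h2 := pow_le_pow_left₀ (abs_nonneg _) h1 2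
    rw [sq_abs, mul_pow, ← Real.rpow_mul_natCast (by positivity)] at h2
    refine h2.trans_eq ?_
    congr 2
    push_cast
    linarith
  refine integral_sq_le_of_legendre_coeff hg fun M => ?_
  have hterm : ∀ i ∈ Finset.Ico n (n + 1 + M), (2 * ((i + 1 : ℕ) : ℝ) + 1) / 2 *
      (∫ x in (-1 : ℝ)..1, (ω x - P.eval x) * (legendreP (i + 1)).eval x) ^ 2 ≤
      3 * K ^ 2 * ((i : ℝ) + 1) ^ (-q - 1) + if i = n then (2 * (n : ℝ) + 3) * f ^ 2 else 0 := by
    intro i hi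
    have hi := (Finset.mem_Ico.1 hi).1
    rw [hhigh i hi]
    have h1 := hcb i hi
    have hx : (0 : ℝ) < (i : ℝ) + 1 := by positivity
    have h2 : ((i : ℝ) + 1) ^ (-q - 1) = ((i : ℝ) + 1) * ((i : ℝ) + 1) ^ (-q - 2) := by
      nth_rewrite 2 [← Real.rpow_one ((i : ℝ) + 1)]
      rw [← Real.rpow_add hx]
      ring_nf
    have h3 : (2 * (i : ℝ) + 3) * c i ^ 2 ≤ 3 * K ^ 2 * ((i : ℝ) + 1) ^ (-q - 1) := by
      rw [h2]
      calc (2 * (i : ℝ) + 3) * c i ^ 2 ≤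
            (3 * ((i : ℝ) + 1)) * (K ^ 2 * ((i : ℝ) + 1) ^ (-q - 2)) := by
            gcongr
            linarith
        _ = _ := by ring
    push_cast
    split_ifs with h
    · subst h
      nlinarith [mul_nonneg (by positivity : 0 ≤ 2 * (i : ℝ) + 3) (sq_nonneg (c i + f))]
    · nlinarith [mul_nonneg (by positivity : 0 ≤ 2 * (i : ℝ) + 3) (sq_nonneg (c i))]
  have hf2 : (2 * (n : ℝ) + 3) * f ^ 2 ≤ 2 * D ^ 2 * ((n : ℝ) + 1)⁻¹ := by
    have h1 := pow_le_pow_left₀ (abs_nonneg _) hD 2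
    rw [sq_abs] at h1
    calc (2 * (n : ℝ) + 3) * f ^ 2 ≤ (2 * (n : ℝ) + 3) * (2 / (2 * (n : ℝ) + 3) * D) ^ 2 := by
          gcongr
      _ = 2 * D ^ 2 * ((n : ℝ) + 3 / 2)⁻¹ := by field_simp
      _ ≤ _ := by gcongr; norm_num
  set t : ℕ → ℝ := fun j => (2 * (j : ℝ) + 1) / 2 *
    (∫ x in (-1 : ℝ)..1, (ω x - P.eval x) * (legendreP j).eval x) ^ 2 with ht
  have ht0 : ∀ j < n + 1, t j = 0 := fun j hj => by
    rw [ht]; simp only [hlow j hj]; ring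
  calc ∑ j ∈ Finset.range M, t j ≤ ∑ j ∈ Finset.range (n + 1 + M + 1), t j :=
        Finset.sum_le_sum_of_subset_of_nonneg (Finset.range_subset_range.2 (by omega))
          fun j _ _ => by rw [ht]; positivity
    _ = ∑ i ∈ Finset.Ico n (n + 1 + M), t (i + 1) := by
        rw [Finset.sum_range_succ', ht0 0 (by omega), add_zero]
        refine (Finset.sum_subset (fun i hi => ?_) fun i hi hi' => ?_).symm
        · exact Finset.mem_range.2 (Finset.mem_Ico.1 hi).2
        · rw [Finset.mem_range] at hi
          rw [Finset.mem_Ico] at hi'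
          exact ht0 _ (by omega)
    _ ≤ ∑ i ∈ Finset.Ico n (n + 1 + M), (3 * K ^ 2 * ((i : ℝ) + 1) ^ (-q - 1) +
          if i = n then (2 * (n : ℝ) + 3) * f ^ 2 else 0) := Finset.sum_le_sum hterm
    _ = 3 * K ^ 2 * ∑ i ∈ Finset.Ico n (n + 1 + M), ((i : ℝ) + 1) ^ (-q - 1) +
          (2 * (n : ℝ) + 3) * f ^ 2 := by
        rw [Finset.sum_add_distrib, ← Finset.mul_sum, Finset.sum_ite_eq',
          if_pos (Finset.mem_Ico.2 ⟨le_rfl, by omega⟩)]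
    _ ≤ _ := by
        gcongr
        exact hS _ _

theorem UsemiR_nonneg (k m : ℕ) (α : ℝ) (ω : ℝ → ℝ) (L : ℕ → ℝ) : 0 ≤ UsemiR k m α ω L :=
  add_nonneg (intervalIntegral.integral_nonneg (by norm_num) fun _ _ => abs_nonneg _)
    (Finset.sum_nonneg fun _ _ => abs_nonneg _)

theorem exists_sqrt_integral_radau_error_le {k m : ℕ} {α b r σ : ℝ}
    (hα1 : (k : ℝ) < α) (hα2 : α < (k : ℝ) + 1) (hm : 1 ≤ m)
    (hra : r ≤ min (2 * α + 2) (α + m + 1 / 2) - 1) (hrb : r ≤ b + 1 / 2)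
    (hσ : ∃ K, 0 ≤ K ∧ ∀ n ≥ k, ∀ (ω : ℝ → ℝ) (L : ℕ → ℝ), MemUR (k + 1) m α ω L →
      |∫ x in (-1 : ℝ)..1, iteratedDeriv 1 ω x *
          (C (1 / 2) * legendreP (n + 1) + C (σ / 2) * legendreP n).eval x| ≤
        K * ((n : ℝ) + 1) ^ (-b) * UsemiR (k + 1) m α ω L) :
    ∃ K > 0, ∀ n ≥ k, ∀ (ω : ℝ → ℝ) (L : ℕ → ℝ), MemUR (k + 1) m α ω L →
      ∀ P : ℝ[X], P.natDegree ≤ n + 1 →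
        (∀ v : ℝ[X], v.natDegree < n + 1 →
          ∫ x in (-1 : ℝ)..1, (P.eval x - ω x) * v.eval x = 0) →
        (σ = 1 ∧ P.eval 1 = ω 1 ∨ σ = -1 ∧ P.eval (-1) = ω (-1)) →
        Real.sqrt (∫ x in (-1 : ℝ)..1, (ω x - P.eval x) ^ 2) ≤
          K * ((n + 1 : ℕ) : ℝ) ^ (-r) * UsemiR (k + 1) m α ω L := by
  obtain ⟨K₁, -, hK₁⟩ := exists_abs_integral_deriv_mul_legendreAnti_le hα1 hα2 hm
  obtain ⟨K₂, -, hK₂⟩ := hσ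
  set a := min (2 * α + 2) (α + m + 1 / 2) with ha
  have hk := Nat.cast_nonneg (α := ℝ) k
  have hm' : (1 : ℝ) ≤ m := by exact_mod_cast hm
  have ha1 : 1 < a := lt_min (by linarith) (by linarith)
  obtain ⟨S, hS0, hS⟩ := exists_sum_Ico_rpow_le (q := 2 * a - 2) (by linarith)
  refine ⟨3 * K₁ ^ 2 * S + 2 * K₂ ^ 2 + 1, by positivity, fun n hn ω L hω P hP horth hend => ?_⟩
  set U := UsemiR (k + 1) m α ω L
  have hU : 0 ≤ U := UsemiR_nonneg _ _ _ _ _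
  set x := (n : ℝ) + 1 with hx
  have hx1 : 1 ≤ x := by simp [hx]
  have hx0 : 0 < x := by linarith
  have hsq : (x ^ (-r)) ^ 2 = x ^ (-(2 * r)) := by
    rw [← Real.rpow_mul_natCast hx0.le]; push_cast; ring_nf
  have hpow₁ : x ^ (-(2 * a - 2)) ≤ (x ^ (-r)) ^ 2 := by
    rw [hsq]
    exact Real.rpow_le_rpow_of_exponent_le hx1 (by linarith)
  have hpow₂ : (x ^ (-b)) ^ 2 * x⁻¹ ≤ (x ^ (-r)) ^ 2 := by
    rw [hsq, ← Real.rpow_mul_natCast hx0.le, ← Real.rpow_neg_one, ← Real.rpow_add hx0]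
    exact Real.rpow_le_rpow_of_exponent_le hx1 (by push_cast; linarith)
  have hmain := hω.integral_sq_sub_le (a := a) (q := 2 * a - 2) (K := K₁ * U)
    (D := K₂ * x ^ (-b) * U) horth hP
    (fun j hj => (hK₁ j (hn.trans hj) ω L hω).trans_eq (by ring))
    (by
      rw [hω.abs_integral_radau_mul_legendreP hP horth hend]
      exact mul_le_mul_of_nonneg_left (hK₂ n hn ω L hω) (by positivity))
    (by ring) hS
  push_cast
  refine Real.sqrt_le_iff.2 ⟨by positivity, hmain.trans ?_⟩
  calc 3 * (K₁ * U) ^ 2 * (S * x ^ (-(2 * a - 2))) + 2 * (K₂ * x ^ (-b) * U) ^ 2 * x⁻¹ =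
        3 * K₁ ^ 2 * S * U ^ 2 * x ^ (-(2 * a - 2)) +
          2 * K₂ ^ 2 * U ^ 2 * ((x ^ (-b)) ^ 2 * x⁻¹) := by ring
    _ ≤ 3 * K₁ ^ 2 * S * U ^ 2 * (x ^ (-r)) ^ 2 + 2 * K₂ ^ 2 * U ^ 2 * (x ^ (-r)) ^ 2 := by gcongr
    _ = (3 * K₁ ^ 2 * S + 2 * K₂ ^ 2) * (x ^ (-r) * U) ^ 2 := by ring
    _ ≤ (3 * K₁ ^ 2 * S + 2 * K₂ ^ 2 + 1) ^ 2 * (x ^ (-r) * U) ^ 2 := by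
        gcongr
        nlinarith [show 0 ≤ 3 * K₁ ^ 2 * S + 2 * K₂ ^ 2 by positivity]
    _ = _ := by ring

/-- `L²` estimates for the Gauss–Radau projections `Π_p^±` of
`ω ∈ 𝒰^{α,m}_{1−}((−1,1))` (right-endpoint singularity). -/
theorem stmt_11 (k m : ℕ) (hk : 1 ≤ k) (hm : 1 ≤ m) (α : ℝ)
    (hα1 : (k : ℝ) - 1 < α) (hα2 : α < (k : ℝ)) (hαint : ∀ j : ℤ, α ≠ (j : ℝ))
    (hαm : 1 / 2 < α + (m : ℝ)) :
    ∃ C > (0 : ℝ), ∀ p : ℕ, α + (m : ℝ) < (p : ℝ) + 1 →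
      ∀ (ω : ℝ → ℝ) (L : ℕ → ℝ), MemUR k m α ω L →
        (∀ P : Polynomial ℝ, P.natDegree ≤ p →
          (∀ v : Polynomial ℝ, v.natDegree < p →
              ∫ x in (-1 : ℝ)..1, (P.eval x - ω x) * v.eval x = 0) →
          P.eval 1 = ω 1 →
          Real.sqrt (∫ x in (-1 : ℝ)..1, (ω x - P.eval x) ^ 2) ≤
            C * (p : ℝ) ^ (-(min (2 * α + 1 / 2) (α + (m : ℝ) - 1 / 2))) *
              UsemiR k m α ω L) ∧
        (∀ P : Polynomial ℝ, P.natDegree ≤ p →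
          (∀ v : Polynomial ℝ, v.natDegree < p →
              ∫ x in (-1 : ℝ)..1, (P.eval x - ω x) * v.eval x = 0) →
          P.eval (-1) = ω (-1) →
          Real.sqrt (∫ x in (-1 : ℝ)..1, (ω x - P.eval x) ^ 2) ≤
            C * (p : ℝ) ^ (-(min (2 * α + 1) (α + (m : ℝ) - 1 / 2))) *
              UsemiR k m α ω L) := by
  obtain ⟨k, rfl⟩ := Nat.exists_eq_add_of_le' hk
  have hα1' : (k : ℝ) < α := by push_cast at hα1; linarith
  have hα2' : α < (k : ℝ) + 1 := by push_cast at hα2; linarith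
  obtain ⟨C₁, hC₁, h₁⟩ := exists_sqrt_integral_radau_error_le (σ := 1)
    (r := min (2 * α + 1 / 2) (α + m - 1 / 2)) hα1' hα2' hm
    (by rw [← min_sub_sub_right]; exact min_le_min (by linarith) (by linarith))
    (by rw [← min_add_add_right]; exact min_le_min (by linarith) (by linarith))
    (exists_abs_integral_deriv_mul_sum_le hα1' hα2' hm)
  obtain ⟨C₂, hC₂, h₂⟩ := exists_sqrt_integral_radau_error_le (σ := -1)
    (r := min (2 * α + 1) (α + m - 1 / 2)) hα1' hα2' hm
    (by rw [← min_sub_sub_right]; exact min_le_min (by linarith) (by linarith))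
    (by rw [← min_add_add_right]; exact min_le_min (by linarith) (by linarith))
    (exists_abs_integral_deriv_mul_diff_le hα1' hα2' hm)
  refine ⟨max C₁ C₂, lt_max_of_lt_left hC₁, fun p hp ω L hω => ?_⟩
  have hkp : k < p := by
    have hm' : (1 : ℝ) ≤ m := by exact_mod_cast hm
    exact_mod_cast (by linarith : (k : ℝ) < p)
  obtain ⟨n, rfl⟩ := Nat.exists_eq_add_of_lt hkp
  have hU := UsemiR_nonneg (k + 1) m α ω L
  refine ⟨fun P hP horth hend => ?_, fun P hP horth hend => ?_⟩
  · refine (h₁ (k + n) (by omega) ω L hω P hP horth (Or.inl ⟨rfl, hend⟩)).trans ?_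
    gcongr
    exact le_max_left _ _
  · refine (h₂ (k + n) (by omega) ω L hω P hP horth (Or.inr ⟨rfl, hend⟩)).trans ?_
    gcongr
    exact le_max_right _ _
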